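/- Let G be a 2-connected plane graph in which each vertex is adjacent to at least 3 distinct vertices, let Z be an anchor of G, let Y ⊆ V(G) \ Z, and let E_Y be the set of edges with both endpoints in Y. Then the number of faces of G incident with exactly 2 vertices of Y is at most 3|Y| + |Z| + |E_Y|. -/

import Mathlib

/-- A loopless-or-not multigraph on vertex type `V` with edge type `E`:
each edge has a pair of endpoints. -/
structure Multigraph (V E : Type) where
  ends : E → Sym2 V

namespace Multigraph

variable {V E : Type}

/-- A multigraph is loopless if no edge has equal endpoints. -/
def Loopless (G : Multigraph V E) : Prop := ∀ e, ¬ (G.ends e).IsDiag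

/-- The degree of a vertex: the number of edges incident with it. -/
noncomputable def degree (G : Multigraph V E) (v : V) : ℕ :=
  Set.ncard {e : E | v ∈ G.ends e}

/-- Two (distinct) vertices are adjacent if some edge joins them. -/
def Adj (G : Multigraph V E) (u v : V) : Prop := u ≠ v ∧ ∃ e, G.ends e = s(u, v)

/-- One adjacency step avoiding a vertex set `A` and an edge set `S`. -/
def AdjAvoid (G : Multigraph V E) (A : Set V) (S : Set E) (u v : V) : Prop :=
  u ∉ A ∧ v ∉ A ∧ ∃ e, e ∉ S ∧ G.ends e = s(u, v)

/-- Reachability in the graph obtained by deleting the vertices `A` and edges `S`. -/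
def Reach (G : Multigraph V E) (A : Set V) (S : Set E) : V → V → Prop :=
  Relation.ReflTransGen (G.AdjAvoid A S)

/-- The graph minus the vertex set `A` is connected. -/
def ConnectedAvoiding (G : Multigraph V E) (A : Set V) : Prop :=
  ∀ u v : V, u ∉ A → v ∉ A → G.Reach A ∅ u v

def Connected (G : Multigraph V E) : Prop := G.ConnectedAvoiding ∅

def TwoConnected (G : Multigraph V E) : Prop :=
  3 ≤ Nat.card V ∧ ∀ x : V, G.ConnectedAvoiding {x}

/-- `{f, g}` is a 2-edge-cut: removing both destroys some reachability. -/
def IsTwoEdgeCut (G : Multigraph V E) (f g : E) : Prop :=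
  f ≠ g ∧ ∃ u v : V, G.Reach ∅ ∅ u v ∧ ¬ G.Reach ∅ {f, g} u v

/-- `{u, v}` is a 2-vertex-cut. -/
def IsVertexCut2 (G : Multigraph V E) (u v : V) : Prop :=
  u ≠ v ∧ ∃ x y : V, x ∉ ({u, v} : Set V) ∧ y ∉ ({u, v} : Set V) ∧ ¬ G.Reach {u, v} ∅ x y

/-- `K` is (the vertex set of) a connected component of `G − A`. -/
def IsCompAvoiding (G : Multigraph V E) (A : Set V) (K : Set V) : Prop :=
  ∃ x, x ∉ A ∧ K = {y | y ∉ A ∧ G.Reach A ∅ x y}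

/-- `Z` is an anchor: no vertex of `Z` lies in a 2-vertex-cut, and every
nontrivial bridge (i.e. component of `G − {u,v}`) of every 2-vertex-cut `{u,v}`
contains a vertex of `Z`. -/
def IsAnchor (G : Multigraph V E) (Z : Set V) : Prop :=
  (∀ z ∈ Z, ∀ u v : V, G.IsVertexCut2 u v → z ≠ u ∧ z ≠ v) ∧
  (∀ u v : V, G.IsVertexCut2 u v → ∀ K : Set V, G.IsCompAvoiding {u, v} K → ∃ z ∈ Z, z ∈ K)

/-- A (simple) path from `u` to `v` in a multigraph: a list of pairwise distinct
vertices together with the list of edges joining the consecutive vertices. -/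
structure MPath (G : Multigraph V E) (u v : V) where
  verts : List V
  edges : List E
  len_eq : verts.length = edges.length + 1
  head_eq : verts.head? = some u
  last_eq : verts.getLast? = some v
  ends_eq : ∀ i : ℕ, (hi : i < edges.length) →
    G.ends (edges.get ⟨i, hi⟩) =
      s(verts.get ⟨i, by omega⟩, verts.get ⟨i + 1, by omega⟩)
  vnodup : verts.Nodup
  enodup : edges.Nodup

/-- The internal vertices of a path: all vertices but the two endpoints. -/
def MPath.internal {G : Multigraph V E} {u v : V} (p : G.MPath u v) : List V :=
  (p.verts.drop 1).dropLast

/-- A branch: a nontrivial path whose endpoints have degree at least 3 and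
whose internal vertices have degree 2. -/
def IsBranchPath (G : Multigraph V E) {u v : V} (p : G.MPath u v) : Prop :=
  p.edges ≠ [] ∧ 3 ≤ G.degree u ∧ 3 ≤ G.degree v ∧ ∀ w ∈ p.internal, G.degree w = 2

/-- The edge sets of branches with both endpoints in `B` (a branch is determined,
up to reversal, by its edge set). -/
def branchSets (G : Multigraph V E) (B : Set V) : Set (Set E) :=
  {S | ∃ u v, u ∈ B ∧ v ∈ B ∧ ∃ p : G.MPath u v, G.IsBranchPath p ∧ {e | e ∈ p.edges} = S}

/-- An `(ℓ, Δ)`-earring: a base edge `uv` plus two distinct `uv`-paths avoiding the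
base edge, of length at most `ℓ`, with internal vertices of degree `< Δ`, and such
that every common edge `f` of the two paths makes `{base, f}` a 2-edge-cut. -/
structure Earring (G : Multigraph V E) (ℓ Δ : ℕ) where
  base : E
  u : V
  v : V
  une : u ≠ v
  ends_base : G.ends base = s(u, v)
  P : G.MPath u v
  Q : G.MPath u v
  PQ_distinct : P.verts ≠ Q.verts ∨ P.edges ≠ Q.edges
  base_not_P : base ∉ P.edges
  base_not_Q : base ∉ Q.edges
  lenP : P.edges.length ≤ ℓ
  lenQ : Q.edges.length ≤ ℓ
  degP : ∀ w ∈ P.internal, G.degree w < Δ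
  degQ : ∀ w ∈ Q.internal, G.degree w < Δ
  common_cut : ∀ f, f ∈ P.edges → f ∈ Q.edges → G.IsTwoEdgeCut base f

def Earring.edgeSet {G : Multigraph V E} {ℓ Δ : ℕ} (X : G.Earring ℓ Δ) : Set E :=
  {X.base} ∪ {e | e ∈ X.P.edges} ∪ {e | e ∈ X.Q.edges}

def Earring.vertexSet {G : Multigraph V E} {ℓ Δ : ℕ} (X : G.Earring ℓ Δ) : Set V :=
  {w | w ∈ X.P.verts ∨ w ∈ X.Q.verts}

/-- A drawing of a multigraph in the plane: an injective placement of the vertices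
together with, for each edge, a simple arc joining the placements of its endpoints,
whose interior avoids all vertices. -/
structure Drawing (G : Multigraph V E) where
  vpos : V → ℝ × ℝ
  arc : E → ℝ → ℝ × ℝ
  vpos_inj : Function.Injective vpos
  arc_cont : ∀ e, ContinuousOn (arc e) (Set.Icc 0 1)
  arc_inj : ∀ e, Set.InjOn (arc e) (Set.Icc 0 1)
  arc_ends : ∀ e, ∃ x y : V, G.ends e = s(x, y) ∧ arc e 0 = vpos x ∧ arc e 1 = vpos y
  arc_avoid : ∀ e, ∀ t ∈ Set.Ioo (0:ℝ) 1, ∀ x : V, arc e t ≠ vpos x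

/-- The (doubly counted) set of crossings of a drawing: interior points where two
distinct edges meet. -/
def Drawing.CrossSet {G : Multigraph V E} (D : G.Drawing) : Set ((E × E) × ℝ × ℝ) :=
  {q | q.1.1 ≠ q.1.2 ∧ q.2.1 ∈ Set.Ioo (0:ℝ) 1 ∧ q.2.2 ∈ Set.Ioo (0:ℝ) 1 ∧
    D.arc q.1.1 q.2.1 = D.arc q.1.2 q.2.2}

/-- A good drawing: one with finitely many crossings. -/
structure GoodDrawing (G : Multigraph V E) extends G.Drawing where
  finCross : toDrawing.CrossSet.Finite

/-- The number of crossings of a good drawing (each crossing is recorded twice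
in `CrossSet`). -/
noncomputable def GoodDrawing.crossings {G : Multigraph V E} (D : G.GoodDrawing) : ℕ :=
  D.toDrawing.CrossSet.ncard / 2

/-- The crossing number: the least number of crossings of a drawing. -/
noncomputable def crNum (G : Multigraph V E) : ℕ :=
  sInf {n : ℕ | ∃ D : G.GoodDrawing, D.crossings = n}

/-- A multigraph is planar if it has a crossing-free drawing. -/
def IsPlanar (G : Multigraph V E) : Prop := ∃ D : G.Drawing, D.CrossSet = ∅

/-- Deleting a set of edges. -/
def delete (G : Multigraph V E) (S : Set E) : Multigraph V {e : E // e ∉ S} :=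
  ⟨fun e => G.ends e.1⟩

/-- The image (point set) of a drawing in the plane. -/
def Drawing.image {G : Multigraph V E} (D : G.Drawing) : Set (ℝ × ℝ) :=
  Set.range D.vpos ∪ ⋃ e : E, D.arc e '' Set.Icc 0 1

/-- The faces of a drawing: the connected components of the complement of its image. -/
def Drawing.Faces {G : Multigraph V E} (D : G.Drawing) : Set (Set (ℝ × ℝ)) :=
  {C | ∃ p ∉ D.image, C = connectedComponentIn D.imageᶜ p}

/-- A vertex is incident with a face if its placement lies on the face's closure. -/
def Drawing.FaceIncident {G : Multigraph V E} (D : G.Drawing) (x : V) (C : Set (ℝ × ℝ)) :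
    Prop := D.vpos x ∈ closure C

/-- The weighted number of crossings of a good drawing. -/
noncomputable def GoodDrawing.wcross {G : Multigraph V E} (D : G.GoodDrawing)
    (w : E → ℝ) : ℝ :=
  (∑ q ∈ D.finCross.toFinset, w q.1.1 * w q.1.2) / 2

/-- The weighted crossing number of `(G, w)`. -/
noncomputable def wcr (G : Multigraph V E) (w : E → ℝ) : ℝ :=
  sInf {x : ℝ | ∃ D : G.GoodDrawing, D.wcross w = x}

end Multigraph

/-- The uniform probability measure on `[0,1]^E`, modelling i.i.d. uniform `[0,1]`
weights on the edges. -/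
noncomputable def cubeMeasure (E : Type) [Fintype E] : MeasureTheory.Measure (E → ℝ) :=
  (MeasureTheory.volume : MeasureTheory.Measure (E → ℝ)).restrict
    {w | ∀ e, w e ∈ Set.Icc (0:ℝ) 1}

section

namespace PlaneTopology

open Set Topology

/-- The function `f` has a continuous logarithm on `A`. -/
def HasLogOn {X : Type*} [TopologicalSpace X] (f : X → ℂ) (A : Set X) : Prop :=
  ∃ g : X → ℂ, ContinuousOn g A ∧ ∀ z ∈ A, Complex.exp (g z) = f z

theorem exists_glue_closed {X Y : Type*} [TopologicalSpace X] [TopologicalSpace Y] {A B : Set X}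
    (hA : IsClosed A) (hB : IsClosed B) {f g : X → Y} (hf : ContinuousOn f A)
    (hg : ContinuousOn g B) (h : ∀ x ∈ A, x ∈ B → f x = g x) :
    ∃ F : X → Y, ContinuousOn F (A ∪ B) ∧ EqOn F f A ∧ EqOn F g B := by
  classical
  have h1 : EqOn (A.piecewise f g) f A := fun x hx => piecewise_eq_of_mem _ _ _ hx
  have h2 : EqOn (A.piecewise f g) g B := fun x hx => by
    by_cases hxA : x ∈ A
    · rw [piecewise_eq_of_mem _ _ _ hxA, h x hxA hx]
    · exact piecewise_eq_of_notMem _ _ _ hxA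
  exact ⟨_, (hf.congr h1).union_of_isClosed (hg.congr h2) hA hB, h1, h2⟩

theorem exists_glue_open {X Y : Type*} [TopologicalSpace X] [TopologicalSpace Y] {A B : Set X}
    (hA : IsOpen A) (hB : IsOpen B) {f g : X → Y} (hf : ContinuousOn f A)
    (hg : ContinuousOn g B) (h : ∀ x ∈ A, x ∈ B → f x = g x) :
    ∃ F : X → Y, ContinuousOn F (A ∪ B) ∧ EqOn F f A ∧ EqOn F g B := by
  classical
  have h1 : EqOn (A.piecewise f g) f A := fun x hx => piecewise_eq_of_mem _ _ _ hx
  have h2 : EqOn (A.piecewise f g) g B := fun x hx => by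
    by_cases hxA : x ∈ A
    · rw [piecewise_eq_of_mem _ _ _ hxA, h x hxA hx]
    · exact piecewise_eq_of_notMem _ _ _ hxA
  exact ⟨_, (hf.congr h1).union_of_isOpen (hg.congr h2) hA hB, h1, h2⟩

theorem isSimplyConnected_univ_of_normedSpace (X : Type*) [NormedAddCommGroup X]
    [NormedSpace ℝ X] : IsSimplyConnected (univ : Set X) := by
  have := (convex_univ (𝕜 := ℝ) (E := X)).contractibleSpace univ_nonempty
  exact SimplyConnectedSpace.ofContractible _

theorem hasLogOn_univ {f : ℂ → ℂ} (hf : Continuous f) (h0 : ∀ z, f z ≠ 0) : HasLogOn f univ := by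
  obtain ⟨g, hg, h⟩ := Complex.exists_continuousOn_eqOn_exp_comp (U := (univ : Set ℂ))
    (isSimplyConnected_univ_of_normedSpace _) isOpen_univ hf.continuousOn
    (by rintro ⟨z, -, hz⟩; exact h0 z hz)
  exact ⟨g, hg, fun z hz => h hz⟩

theorem hasLogOn_univ_real {f : ℝ → ℂ} (hf : Continuous f) (h0 : ∀ z, f z ≠ 0) :
    HasLogOn f univ := by
  obtain ⟨g, hg, h⟩ := Complex.exists_continuousOn_eqOn_exp_comp (U := (univ : Set ℝ))
    (isSimplyConnected_univ_of_normedSpace _) isOpen_univ hf.continuousOn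
    (by rintro ⟨z, -, hz⟩; exact h0 z hz)
  exact ⟨g, hg, fun z hz => h hz⟩

/-- Every nonvanishing continuous function on `A` has a continuous logarithm. -/
def HasLogs (A : Set ℂ) : Prop :=
  ∀ f : ℂ → ℂ, ContinuousOn f A → (∀ z ∈ A, f z ≠ 0) → HasLogOn f A

theorem hasLogs_arc {e : ℝ → ℂ} {a b : ℝ} (hab : a ≤ b) (he : ContinuousOn e (Icc a b))
    (hi : InjOn e (Icc a b)) : HasLogs (e '' Icc a b) := by
  intro f hf h0
  have hE : IsClosedEmbedding (fun t : Icc a b => e t) :=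
    (continuousOn_iff_continuous_domRestrict.1 he).isClosedEmbedding
      (fun s t h => Subtype.ext (hi s.2 t.2 h))
  obtain ⟨g, hg, hgf⟩ := hasLogOn_univ_real (f := fun t => f (e (projIcc a b hab t)))
    (by
      have h1 : Continuous fun t : Icc a b => f (e t) :=
        hf.comp_continuous hE.continuous (fun t => mem_image_of_mem _ t.2)
      exact h1.comp continuous_projIcc)
    (fun t => h0 _ (mem_image_of_mem _ (projIcc a b hab t).2))
  rw [continuousOn_univ] at hg
  obtain ⟨G, hG⟩ := ContinuousMap.exists_extension hE ⟨fun t : Icc a b => g t, by fun_prop⟩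
  refine ⟨G, G.continuous.continuousOn, ?_⟩
  rintro _ ⟨t, ht, rfl⟩
  have h1 : G (e t) = g t := congr($hG ⟨t, ht⟩)
  rw [h1, hgf t (mem_univ _)]
  simp only [projIcc_of_mem hab ht]

theorem hasLogOn_compl_path {a b : ℂ} (γ : Path a b) :
    HasLogOn (fun z => (z - a) / (z - b)) (range γ)ᶜ := by
  let A := ((range γ)ᶜ : Set ℂ)
  have hA : ∀ z : A, ∀ t, (z : ℂ) - γ t ≠ 0 := fun z t h =>
    z.2 ⟨t, (sub_eq_zero.1 h).symm⟩
  have hb : ∀ z : A, (z : ℂ) - b ≠ 0 := fun z => by simpa using hA z 1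
  let H : C(unitInterval × A, {z : ℂ // z ≠ 0}) :=
    ⟨fun x => ⟨((x.2 : ℂ) - γ (unitInterval.symm x.1)) / ((x.2 : ℂ) - b),
      div_ne_zero (hA _ _) (hb _)⟩, by
      refine Continuous.subtype_mk (Continuous.div ?_ ?_ fun x => hb _) _
      · fun_prop
      · fun_prop⟩
  let f : C(A, ℂ) := ContinuousMap.const _ 0
  have H0 : ∀ z : A, H (0, z) = (⟨_, (f z).exp_ne_zero⟩ : {z : ℂ // z ≠ 0}) := fun z => by
    apply Subtype.ext
    simp [H, f, div_self (hb z)]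
  let L := Complex.isCoveringMap_exp.liftHomotopy H f H0
  have hL := Complex.isCoveringMap_exp.liftHomotopy_lifts H f H0
  classical
  refine ⟨fun z => if hz : z ∈ A then L (1, ⟨z, hz⟩) else 0, ?_, fun z hz => ?_⟩
  · rw [continuousOn_iff_continuous_domRestrict]
    have : (range γ)ᶜ.domRestrict (fun z => if hz : z ∈ A then L (1, ⟨z, hz⟩) else 0) =
        fun z : A => L (1, z) := by
      ext z
      have hz : (z : ℂ) ∈ A := z.2
      simp [Set.domRestrict, hz]
    rw [this]
    fun_prop
  · have h1 := congrArg Subtype.val (congrFun hL (1, ⟨z, hz⟩))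
    have hz' : z ∈ A := hz
    simp only [hz', dif_pos]
    have h2 : Complex.exp (L (1, ⟨z, hz⟩)) = (z - γ (unitInterval.symm 1)) / (z - b) := h1
    simpa using h2

theorem exists_int_of_exp_eq {z w : ℂ} (h : Complex.exp z = Complex.exp w) :
    ∃ n : ℤ, z = w + n * (2 * Real.pi * Complex.I) := Complex.exp_eq_exp_iff_exists_int.1 h

theorem exp_int_mul_two_pi (n : ℤ) : Complex.exp (n * (2 * Real.pi * Complex.I)) = 1 :=
  Complex.exp_int_mul_two_pi_mul_I n

theorem logs_differ_by_const {X : Type*} [TopologicalSpace X] {S : Set X} (hS : IsPreconnected S)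
    {f g : X → ℂ} (hf : ContinuousOn f S) (hg : ContinuousOn g S)
    (h : ∀ x ∈ S, Complex.exp (f x) = Complex.exp (g x)) :
    ∃ n : ℤ, ∀ x ∈ S, f x = g x + n * (2 * Real.pi * Complex.I) := by
  rcases S.eq_empty_or_nonempty with rfl | ⟨x₀, hx₀⟩
  · exact ⟨0, by simp⟩
  have hpi : (2 * Real.pi * Complex.I : ℂ) ≠ 0 := Complex.two_pi_I_ne_zero
  let d : X → ℝ := fun x => ((f x - g x) / (2 * Real.pi * Complex.I)).re
  have hd : ContinuousOn d S :=
    Complex.continuous_re.comp_continuousOn ((hf.sub hg).div_const _)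
  have hd' : ∀ x ∈ S, ∃ n : ℤ, d x = n ∧ f x = g x + n * (2 * Real.pi * Complex.I) :=
    fun x hx => by
      obtain ⟨n, hn⟩ := exists_int_of_exp_eq (h x hx)
      refine ⟨n, ?_, hn⟩
      simp only [d]
      rw [hn, add_sub_cancel_left, mul_div_cancel_right₀ _ hpi]
      simp
  have hdisc : IsDiscrete (range ((↑) : ℤ → ℝ)) := by
    rw [isDiscrete_iff_discreteTopology]
    exact Int.isClosedEmbedding_coe_real.isEmbedding.toHomeomorph.symm.isEmbedding.discreteTopology
  have hconst := fun x hx => hS.constant_of_mapsTo hdisc hd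
    (fun x hx => by obtain ⟨n, hn, -⟩ := hd' x hx; exact ⟨n, hn.symm⟩) (x := x) hx hx₀
  obtain ⟨n, hn, -⟩ := hd' x₀ hx₀
  refine ⟨n, fun x hx => ?_⟩
  obtain ⟨m, hm, hm'⟩ := hd' x hx
  have : (m : ℝ) = n := by rw [← hm, ← hn]; exact hconst x hx
  have : m = n := by exact_mod_cast this
  rw [hm', this]

theorem zpow_eq_zero_of_hasLogOn_sphere {c : ℂ} {R : ℝ} (hR : 0 < R) {n : ℤ}
    (h : HasLogOn (fun z => (z - c) ^ n) (Metric.sphere c R)) : n = 0 := by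
  obtain ⟨g, hg, hgn⟩ := h
  have hmem : ∀ θ : ℝ, circleMap c R θ ∈ Metric.sphere c R := circleMap_mem_sphere c hR.le
  have h1 : Continuous fun θ : ℝ => g (circleMap c R θ) :=
    hg.comp_continuous (continuous_circleMap c R) hmem
  obtain ⟨k, hk⟩ := logs_differ_by_const (S := (univ : Set ℝ)) isPreconnected_univ
    (f := fun θ : ℝ => g (circleMap c R θ))
    (g := fun θ : ℝ => n * (Complex.log R + θ * Complex.I))
    h1.continuousOn (by fun_prop) (fun θ _ => by
      have hR' : (R : ℂ) ≠ 0 := by exact_mod_cast hR.ne'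
      rw [hgn _ (hmem θ), Complex.exp_int_mul, Complex.exp_add, Complex.exp_log hR']
      simp [circleMap])
  have h0 := hk 0 (mem_univ _)
  have h2 := hk (2 * Real.pi) (mem_univ _)
  have h3 : circleMap c R (2 * Real.pi) = circleMap c R 0 := by simp [circleMap]
  simp only [h3] at h2
  rw [h0] at h2
  have hpi : (2 * Real.pi * Complex.I : ℂ) ≠ 0 := Complex.two_pi_I_ne_zero
  push_cast at h2
  have h4 : (n : ℂ) * (2 * Real.pi * Complex.I) = 0 := by linear_combination -h2
  simpa [hpi] using h4

theorem HasLogOn.mono {X : Type*} [TopologicalSpace X] {f : X → ℂ} {A B : Set X}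
    (h : HasLogOn f B) (hAB : A ⊆ B) : HasLogOn f A :=
  let ⟨g, hg, hgf⟩ := h
  ⟨g, hg.mono hAB, fun z hz => hgf z (hAB hz)⟩

theorem not_hasLogOn_compl_pair {a b : ℂ} (hab : a ≠ b) :
    ¬ HasLogOn (fun z => (z - a) / (z - b)) ({a, b} : Set ℂ)ᶜ := by
  rintro ⟨L, hL, hLe⟩
  have hab' : a - b ≠ 0 := sub_ne_zero.2 hab
  have hw : ∀ w ∈ Metric.sphere (0 : ℂ) (1 / 2), w ≠ 0 ∧ 1 - w ≠ 0 := fun w hw => by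
    rw [mem_sphere_zero_iff_norm] at hw
    constructor
    · rintro rfl; norm_num at hw
    · intro h
      rw [← sub_eq_zero.1 h] at hw
      norm_num at hw
  have e1 : ∀ w : ℂ, 1 - w ≠ 0 → (a - b * w) / (1 - w) - a = w * (a - b) / (1 - w) :=
    fun w h => by field_simp; ring
  have e2 : ∀ w : ℂ, 1 - w ≠ 0 → (a - b * w) / (1 - w) - b = (a - b) / (1 - w) :=
    fun w h => by field_simp; ring
  have hmaps : ∀ w ∈ Metric.sphere (0 : ℂ) (1 / 2),
      (a - b * w) / (1 - w) ∈ ({a, b} : Set ℂ)ᶜ := fun w h => by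
    obtain ⟨h0, h1⟩ := hw w h
    simp only [mem_compl_iff, mem_insert_iff, mem_singleton_iff, not_or]
    rw [← sub_eq_zero, ← sub_eq_zero (b := b), e1 w h1, e2 w h1]
    exact ⟨div_ne_zero (mul_ne_zero h0 hab') h1, div_ne_zero hab' h1⟩
  have : (1 : ℤ) = 0 := by
    refine zpow_eq_zero_of_hasLogOn_sphere (c := 0) (R := 1 / 2) (by norm_num)
      ⟨fun w => L ((a - b * w) / (1 - w)), ?_, fun w h => ?_⟩
    · refine hL.comp (ContinuousOn.div (by fun_prop) (by fun_prop) fun w h => (hw w h).2) hmaps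
    · obtain ⟨h0, h1⟩ := hw w h
      rw [hLe _ (hmaps w h)]
      simp only [e1 w h1, e2 w h1]
      field_simp
      simp
  norm_num at this

end PlaneTopology

end

section

namespace PlaneTopology

open Set Topology

theorem isPreconnected_polar (c : ℂ) {s : Set ℝ} (hs : s.OrdConnected) (hpos : ∀ r ∈ s, 0 < r) :
    IsPreconnected {z : ℂ | ‖z - c‖ ∈ s} := by
  have h : {z : ℂ | ‖z - c‖ ∈ s} = (fun x : ℝ × ℝ => circleMap c x.1 x.2) '' (s ×ˢ univ) := by
    ext z
    constructor
    · intro hz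
      refine ⟨(‖z - c‖, (z - c).arg), ⟨hz, mem_univ _⟩, ?_⟩
      simp [circleMap, Complex.norm_mul_exp_arg_mul_I]
    · rintro ⟨⟨r, θ⟩, ⟨hr, -⟩, rfl⟩
      simpa [circleMap, abs_of_pos (hpos r hr)] using hr
  rw [h]
  refine (hs.isPreconnected.prod isPreconnected_univ).image _ ?_
  unfold circleMap
  fun_prop

theorem closure_component_subset {X : Type*} [TopologicalSpace X] {K : Set X} {p : X} :
    closure (connectedComponentIn Kᶜ p) ⊆ K ∪ connectedComponentIn Kᶜ p := by
  intro x hx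
  by_cases hp : p ∈ Kᶜ
  · by_contra hxn
    rw [mem_union, not_or] at hxn
    refine hxn.2 ?_
    have hpre : IsPreconnected (insert x (connectedComponentIn Kᶜ p)) :=
      isPreconnected_connectedComponentIn.subset_closure (subset_insert _ _)
        (insert_subset hx subset_closure)
    refine hpre.subset_connectedComponentIn (mem_insert_of_mem _ (mem_connectedComponentIn hp))
      (insert_subset hxn.1 (connectedComponentIn_subset _ _)) (mem_insert _ _)
  · simp [connectedComponentIn_eq_empty hp] at hx

theorem isClosed_union_component {X : Type*} [TopologicalSpace X] {K : Set X} (hK : IsClosed K)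
    {p : X} : IsClosed (K ∪ connectedComponentIn Kᶜ p) := by
  rw [← closure_subset_iff_isClosed, closure_union, hK.closure_eq]
  exact union_subset subset_union_left closure_component_subset

theorem exponent_eq_zero_of_bounded {K : Set ℂ} (hK : IsCompact K) {p : ℂ} (hp : p ∉ K)
    (hb : Bornology.IsBounded (connectedComponentIn Kᶜ p)) {n : ℤ} {h : ℂ → ℂ}
    (hc : ContinuousOn h (K ∪ connectedComponentIn Kᶜ p))
    (h0 : ∀ z ∈ K ∪ connectedComponentIn Kᶜ p, h z ≠ 0)
    (hlog : HasLogOn (fun z => (z - p) ^ n * h z) K) : n = 0 := by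
  obtain ⟨g, hg, hgn⟩ := hlog
  obtain ⟨G, hG⟩ := ContinuousMap.exists_restrict_eq hK.isClosed
    ⟨K.domRestrict g, continuousOn_iff_continuous_domRestrict.1 hg⟩
  have hGg : ∀ z ∈ K, G z = g z := fun z hz => congr($hG ⟨z, hz⟩)
  set U := connectedComponentIn Kᶜ p with hU
  have hUo : IsOpen U := hK.isClosed.isOpen_compl.connectedComponentIn
  have hpU : p ∈ U := mem_connectedComponentIn hp
  have hsub : ∀ z ∈ Uᶜ, z - p ≠ 0 := fun z hz h => hz (by rwa [sub_eq_zero.1 h])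
  obtain ⟨F, hF, hF1, hF2⟩ := exists_glue_closed (isClosed_union_component hK.isClosed)
    hUo.isClosed_compl
    (f := fun z => Complex.exp (G z) / h z) (g := fun z => (z - p) ^ n)
    (ContinuousOn.div (by fun_prop) hc h0)
    (ContinuousOn.zpow₀ (by fun_prop) n fun z hz => Or.inl (hsub z hz))
    (by
      rintro z (hz | hz) hz'
      · rw [hGg z hz, hgn z hz]
        exact mul_div_cancel_right₀ _ (h0 z (Or.inl hz))
      · exact absurd hz hz')
  have huniv : K ∪ U ∪ Uᶜ = univ := by
    rw [union_assoc, union_compl_self, union_univ]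
  rw [huniv, continuousOn_univ] at hF
  have hF0 : ∀ z, F z ≠ 0 := fun z => by
    by_cases hz : z ∈ U
    · rw [hF1 (Or.inr hz)]
      exact div_ne_zero (Complex.exp_ne_zero _) (h0 z (Or.inr hz))
    · rw [hF2 hz]
      exact zpow_ne_zero _ (hsub z hz)
  obtain ⟨R, hR0, hR⟩ : ∃ R : ℝ, 0 < R ∧ U ⊆ Metric.ball p R := hb.subset_ball_lt 0 p
  refine zpow_eq_zero_of_hasLogOn_sphere hR0 (c := p) ?_
  obtain ⟨L, hL, hLF⟩ := hasLogOn_univ hF hF0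
  refine ⟨L, hL.mono (subset_univ _), fun z hz => ?_⟩
  rw [hLF z (mem_univ _), hF2]
  intro hzU
  have := hR hzU
  rw [Metric.mem_ball] at this
  rw [Metric.mem_sphere] at hz
  linarith

theorem hasLogOn_of_mem_component {K : Set ℂ} (hK : IsClosed K) {p q : ℂ} (hp : p ∉ K)
    (hq : q ∈ connectedComponentIn Kᶜ p) : HasLogOn (fun z => (z - p) / (z - q)) K := by
  have hU : IsOpen (connectedComponentIn Kᶜ p) := hK.isOpen_compl.connectedComponentIn
  have hc : IsPathConnected (connectedComponentIn Kᶜ p) :=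
    hU.isConnected_iff_isPathConnected.1 (isConnected_connectedComponentIn_iff.2 hp)
  have hj := hc.joinedIn p (mem_connectedComponentIn hp) q hq
  refine (hasLogOn_compl_path hj.somePath).mono fun z hz => ?_
  rintro ⟨t, rfl⟩
  exact connectedComponentIn_subset _ _ (hj.somePath_mem t) hz

theorem bounded_or_bounded {K : Set ℂ} (hK : IsCompact K) {p q : ℂ}
    (hpq : q ∉ connectedComponentIn Kᶜ p) :
    Bornology.IsBounded (connectedComponentIn Kᶜ p) ∨
      Bornology.IsBounded (connectedComponentIn Kᶜ q) := by
  by_contra hcon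
  rw [not_or] at hcon
  obtain ⟨R, hR0, hR⟩ := hK.isBounded.subset_ball_lt 0 (0 : ℂ)
  have hE : IsPreconnected {z : ℂ | ‖z - 0‖ ∈ Ici R} :=
    isPreconnected_polar 0 ordConnected_Ici fun r hr => lt_of_lt_of_le hR0 hr
  have hEK : {z : ℂ | ‖z - 0‖ ∈ Ici R} ⊆ Kᶜ := fun z hz hzK => by
    have := hR hzK
    rw [Metric.mem_ball, dist_eq_norm] at this
    exact not_lt.2 hz this
  have key : ∀ x, ¬ Bornology.IsBounded (connectedComponentIn Kᶜ x) →
      ∃ y ∈ connectedComponentIn Kᶜ x, {z : ℂ | ‖z - 0‖ ∈ Ici R} ⊆ connectedComponentIn Kᶜ y ∧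
        connectedComponentIn Kᶜ x = connectedComponentIn Kᶜ y ∧ y ∈ {z : ℂ | ‖z - 0‖ ∈ Ici R} := by
    intro x hx
    by_contra hno
    refine hx ((Metric.isBounded_ball (x := (0 : ℂ)) (r := R)).subset fun y hy => ?_)
    by_contra hyR
    have hyE : y ∈ {z : ℂ | ‖z - 0‖ ∈ Ici R} := by
      simpa [Metric.mem_ball, dist_eq_norm] using hyR
    exact hno ⟨y, hy, hE.subset_connectedComponentIn hyE hEK, connectedComponentIn_eq hy, hyE⟩
  obtain ⟨y, hy, -, hxy, hyE⟩ := key p hcon.1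
  obtain ⟨w, hw, hwE, hqw, -⟩ := key q hcon.2
  have h1 : connectedComponentIn Kᶜ w = connectedComponentIn Kᶜ y :=
    connectedComponentIn_eq (hwE hyE)
  refine hpq ?_
  rw [hxy, ← h1, ← hqw]
  refine mem_connectedComponentIn fun hqK => ?_
  rw [connectedComponentIn_eq_empty (by simpa using hqK)] at hw
  exact hw

theorem not_mem_component_symm {X : Type*} [TopologicalSpace X] {F : Set X} {p q : X}
    (h : q ∉ connectedComponentIn F p) : p ∉ connectedComponentIn F q := fun h' => by
  have hq : q ∈ F := by
    by_contra hq
    rw [connectedComponentIn_eq_empty hq] at h'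
    exact h'
  rw [← connectedComponentIn_eq h'] at h
  exact h (mem_connectedComponentIn hq)

theorem sub_ne_zero_of_disjoint {p : ℂ} {A : Set ℂ} (h : p ∉ A) :
    ∀ z ∈ A, z - p ≠ 0 := fun z hz h' => h (by rwa [← sub_eq_zero.1 h'])

/-- Eilenberg's criterion. -/
theorem mem_component_of_hasLogOn {K : Set ℂ} (hK : IsCompact K) {p q : ℂ} (hp : p ∉ K)
    (hq : q ∉ K) (h : HasLogOn (fun z => (z - p) / (z - q)) K) :
    q ∈ connectedComponentIn Kᶜ p := by
  by_contra hpq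
  have hqp := not_mem_component_symm hpq
  rcases bounded_or_bounded hK hpq with hb | hb
  · have h0 : ∀ z ∈ K ∪ connectedComponentIn Kᶜ p, z - q ≠ 0 :=
      sub_ne_zero_of_disjoint (by simp [hq, hpq])
    have : (1 : ℤ) = 0 := exponent_eq_zero_of_bounded hK hp hb (h := fun z => (z - q)⁻¹)
      (ContinuousOn.inv₀ (by fun_prop) h0) (fun z hz => inv_ne_zero (h0 z hz))
      (by simpa [div_eq_mul_inv] using h)
    norm_num at this
  · have h0 : ∀ z ∈ K ∪ connectedComponentIn Kᶜ q, z - p ≠ 0 :=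
      sub_ne_zero_of_disjoint (by simp [hp, hqp])
    have : (-1 : ℤ) = 0 := exponent_eq_zero_of_bounded hK hq hb (h := fun z => (z - p))
      (by fun_prop) h0 (by simpa [div_eq_mul_inv, mul_comm] using h)
    norm_num at this

theorem exists_adjust {K A : Set ℂ} (hKA : (K ∩ A).Subsingleton) {g h : ℂ → ℂ}
    (hgh : ∀ z ∈ K, z ∈ A → Complex.exp (g z) = Complex.exp (h z)) :
    ∃ c : ℂ, Complex.exp c = 1 ∧ ∀ z ∈ K, z ∈ A → g z + c = h z := by
  rcases (K ∩ A).eq_empty_or_nonempty with he | ⟨x, hx, hxA⟩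
  · exact ⟨0, Complex.exp_zero, fun z hz hzA => absurd (show z ∈ K ∩ A from ⟨hz, hzA⟩) (by simp [he])⟩
  · refine ⟨h x - g x, ?_, fun z hz hzA => ?_⟩
    · rw [Complex.exp_sub, hgh x hx hxA, div_self (Complex.exp_ne_zero _)]
    · rw [hKA ⟨hz, hzA⟩ ⟨hx, hxA⟩]; ring

/-- Attaching an arc that meets each of two separated compact sets in at most one point does
not separate any component of the complement. -/
theorem mem_component_union_arc {K₁ K₂ A : Set ℂ} (hK₁ : IsCompact K₁) (hK₂ : IsCompact K₂)
    (hd : Disjoint K₁ K₂) (hA : IsCompact A) (hAl : HasLogs A) (h₁ : (K₁ ∩ A).Subsingleton)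
    (h₂ : (K₂ ∩ A).Subsingleton) {p q : ℂ} (hp : p ∉ K₁ ∪ K₂ ∪ A) (hq : q ∉ K₁ ∪ K₂ ∪ A)
    (hpq : q ∈ connectedComponentIn (K₁ ∪ K₂)ᶜ p) :
    q ∈ connectedComponentIn (K₁ ∪ K₂ ∪ A)ᶜ p := by
  have hK := hK₁.union hK₂
  have hp' := hp
  have hq' := hq
  rw [mem_union, not_or] at hp' hq'
  refine mem_component_of_hasLogOn (hK.union hA) hp hq ?_
  obtain ⟨g, hg, hge⟩ := hasLogOn_of_mem_component hK.isClosed hp'.1 hpq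
  have h0 := sub_ne_zero_of_disjoint hp'.2
  have h0' := sub_ne_zero_of_disjoint hq'.2
  obtain ⟨h, hh, hhe⟩ := hAl (fun z => (z - p) / (z - q))
    (ContinuousOn.div (by fun_prop) (by fun_prop) h0') (fun z hz => div_ne_zero (h0 z hz) (h0' z hz))
  obtain ⟨c₁, hc₁, hc₁'⟩ := exists_adjust h₁ (g := g) (h := h) fun z hz hzA => by
    rw [hge z (Or.inl hz), hhe z hzA]
  obtain ⟨c₂, hc₂, hc₂'⟩ := exists_adjust h₂ (g := g) (h := h) fun z hz hzA => by
    rw [hge z (Or.inr hz), hhe z hzA]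
  obtain ⟨F, hF, hF1, hF2⟩ := exists_glue_closed hK₁.isClosed hK₂.isClosed
    (f := fun z => g z + c₁) (g := fun z => g z + c₂)
    ((hg.mono subset_union_left).add continuousOn_const)
    ((hg.mono subset_union_right).add continuousOn_const)
    (fun z hz hz' => absurd hz' (disjoint_left.1 hd hz))
  obtain ⟨G, hG, hG1, hG2⟩ := exists_glue_closed hK.isClosed hA.isClosed hF hh (by
    rintro z (hz | hz) hzA
    · rw [hF1 hz]; exact hc₁' z hz hzA
    · rw [hF2 hz]; exact hc₂' z hz hzA)
  refine ⟨G, hG, ?_⟩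
  rintro z ((hz | hz) | hz)
  · rw [hG1 (Or.inl hz), hF1 hz]
    simp only
    rw [Complex.exp_add, hc₁, mul_one, hge z (Or.inl hz)]
  · rw [hG1 (Or.inr hz), hF2 hz]
    simp only
    rw [Complex.exp_add, hc₂, mul_one, hge z (Or.inr hz)]
  · rw [hG2 hz, hhe z hz]

/-- An arc attached to a compact set at its two ends splits any component of the complement into
at most two parts. -/
theorem three_points_arc {K A : Set ℂ} (hK : IsCompact K) (hA : IsCompact A) (hAl : HasLogs A)
    {a b : ℂ} (ha : a ∈ K ∩ A) (hb : b ∈ K ∩ A) (hKA : K ∩ A ⊆ {a, b})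
    {p q r : ℂ} (hp : p ∉ K ∪ A) (hq : q ∉ K ∪ A) (hr : r ∉ K ∪ A)
    (hpq : q ∈ connectedComponentIn Kᶜ p) (hqr : r ∈ connectedComponentIn Kᶜ q) :
    q ∈ connectedComponentIn (K ∪ A)ᶜ p ∨ r ∈ connectedComponentIn (K ∪ A)ᶜ q ∨
      r ∈ connectedComponentIn (K ∪ A)ᶜ p := by
  by_contra hcon
  simp only [not_or] at hcon
  obtain ⟨n1, n2, n3⟩ := hcon
  have hKA' := hK.union hA
  have hp' := hp
  have hq' := hq
  have hr' := hr
  rw [mem_union, not_or] at hp' hq' hr'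
  -- for a pair of points, logarithms on the two pieces which agree at `a`
  have pair : ∀ u v : ℂ, u ∉ K ∪ A → v ∉ K ∪ A → v ∈ connectedComponentIn Kᶜ u →
      v ∉ connectedComponentIn (K ∪ A)ᶜ u →
      ∃ (g h : ℂ → ℂ) (n : ℤ), ContinuousOn g K ∧ ContinuousOn h A ∧
        (∀ z ∈ K, Complex.exp (g z) = (z - u) / (z - v)) ∧
        (∀ z ∈ A, Complex.exp (h z) = (z - u) / (z - v)) ∧ g a = h a ∧
        g b = h b + n * (2 * Real.pi * Complex.I) ∧ n ≠ 0 := by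
    intro u v hu hv huv huv'
    have hu' := hu
    have hv' := hv
    rw [mem_union, not_or] at hu' hv'
    obtain ⟨g, hg, hge⟩ := hasLogOn_of_mem_component hK.isClosed hu'.1 huv
    have h0 := sub_ne_zero_of_disjoint hu'.2
    have h0' := sub_ne_zero_of_disjoint hv'.2
    obtain ⟨h, hh, hhe⟩ := hAl (fun z => (z - u) / (z - v))
      (ContinuousOn.div (by fun_prop) (by fun_prop) h0')
      (fun z hz => div_ne_zero (h0 z hz) (h0' z hz))
    obtain ⟨m, hm⟩ := exists_int_of_exp_eq ((hge a ha.1).trans (hhe a ha.2).symm)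
    obtain ⟨k, hk⟩ := exists_int_of_exp_eq ((hge b hb.1).trans (hhe b hb.2).symm)
    refine ⟨g, fun z => h z + m * (2 * Real.pi * Complex.I), k - m, hg, by fun_prop, hge,
      fun z hz => ?_, hm, ?_, ?_⟩
    · rw [Complex.exp_add, exp_int_mul_two_pi, mul_one, hhe z hz]
    · rw [hk]; push_cast; ring
    · intro hkm
      have hkm : k = m := by omega
      refine huv' (mem_component_of_hasLogOn hKA' hu hv ?_)
      obtain ⟨F, hF, hF1, hF2⟩ := exists_glue_closed hK.isClosed hA.isClosed hg
        (g := fun z => h z + m * (2 * Real.pi * Complex.I)) (by fun_prop) (by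
          intro z hz hzA
          rcases hKA ⟨hz, hzA⟩ with rfl | rfl
          · exact hm
          · rw [hk, hkm])
      refine ⟨F, hF, ?_⟩
      rintro z (hz | hz)
      · rw [hF1 hz, hge z hz]
      · rw [hF2 hz]
        simp only
        rw [Complex.exp_add, exp_int_mul_two_pi, mul_one, hhe z hz]
  obtain ⟨g₁, h₁, k₁, hg₁, hh₁, hge₁, hhe₁, ha₁, hb₁, hk₁⟩ := pair p q hp hq hpq n1
  obtain ⟨g₂, h₂, k₂, hg₂, hh₂, hge₂, hhe₂, ha₂, hb₂, hk₂⟩ := pair q r hq hr hqr n2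
  obtain ⟨F, hF, hF1, hF2⟩ := exists_glue_closed hK.isClosed hA.isClosed
    (f := fun z => k₂ * g₁ z - k₁ * g₂ z) (g := fun z => k₂ * h₁ z - k₁ * h₂ z)
    (by fun_prop) (by fun_prop) (by
      intro z hz hzA
      rcases hKA ⟨hz, hzA⟩ with rfl | rfl
      · simp only [ha₁, ha₂]
      · simp only [hb₁, hb₂]; ring)
  have hFe : ∀ z ∈ K ∪ A, Complex.exp (F z) =
      ((z - p) / (z - q)) ^ k₂ / ((z - q) / (z - r)) ^ k₁ := by
    rintro z (hz | hz)
    · rw [hF1 hz]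
      simp only
      rw [Complex.exp_sub, Complex.exp_int_mul, Complex.exp_int_mul, hge₁ z hz, hge₂ z hz]
    · rw [hF2 hz]
      simp only
      rw [Complex.exp_sub, Complex.exp_int_mul, Complex.exp_int_mul, hhe₁ z hz, hhe₂ z hz]
  rcases bounded_or_bounded hKA' n3 with hbd | hbd
  · have hq0 : ∀ z ∈ K ∪ A ∪ connectedComponentIn (K ∪ A)ᶜ p, z - q ≠ 0 :=
      sub_ne_zero_of_disjoint (by rw [mem_union, not_or]; exact ⟨hq, n1⟩)
    have hr0 : ∀ z ∈ K ∪ A ∪ connectedComponentIn (K ∪ A)ᶜ p, z - r ≠ 0 :=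
      sub_ne_zero_of_disjoint (by rw [mem_union, not_or]; exact ⟨hr, n3⟩)
    refine hk₂ (exponent_eq_zero_of_bounded hKA' hp hbd
      (h := fun z => ((z - q) ^ k₂)⁻¹ / ((z - q) / (z - r)) ^ k₁) ?_ ?_ ⟨F, hF, ?_⟩)
    · refine ContinuousOn.div (ContinuousOn.inv₀ (ContinuousOn.zpow₀ (by fun_prop) _ ?_) ?_)
        (ContinuousOn.zpow₀ (ContinuousOn.div (by fun_prop) (by fun_prop) hr0) _ ?_) ?_
      · exact fun z hz => Or.inl (hq0 z hz)
      · exact fun z hz => zpow_ne_zero _ (hq0 z hz)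
      · exact fun z hz => Or.inl (div_ne_zero (hq0 z hz) (hr0 z hz))
      · exact fun z hz => zpow_ne_zero _ (div_ne_zero (hq0 z hz) (hr0 z hz))
    · exact fun z hz => div_ne_zero (inv_ne_zero (zpow_ne_zero _ (hq0 z hz)))
        (zpow_ne_zero _ (div_ne_zero (hq0 z hz) (hr0 z hz)))
    · intro z hz
      rw [hFe z hz, div_zpow (z - p)]
      ring
  · have hp3 := not_mem_component_symm n3
    have hq3 := not_mem_component_symm n2
    have hq0 : ∀ z ∈ K ∪ A ∪ connectedComponentIn (K ∪ A)ᶜ r, z - q ≠ 0 :=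
      sub_ne_zero_of_disjoint (by rw [mem_union, not_or]; exact ⟨hq, hq3⟩)
    have hp0 : ∀ z ∈ K ∪ A ∪ connectedComponentIn (K ∪ A)ᶜ r, z - p ≠ 0 :=
      sub_ne_zero_of_disjoint (by rw [mem_union, not_or]; exact ⟨hp, hp3⟩)
    refine hk₁ (exponent_eq_zero_of_bounded hKA' hr hbd
      (h := fun z => ((z - p) / (z - q)) ^ k₂ / (z - q) ^ k₁) ?_ ?_ ⟨F, hF, ?_⟩)
    · refine ContinuousOn.div
        (ContinuousOn.zpow₀ (ContinuousOn.div (by fun_prop) (by fun_prop) hq0) _ ?_)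
        (ContinuousOn.zpow₀ (by fun_prop) _ ?_) ?_
      · exact fun z hz => Or.inl (div_ne_zero (hp0 z hz) (hq0 z hz))
      · exact fun z hz => Or.inl (hq0 z hz)
      · exact fun z hz => zpow_ne_zero _ (hq0 z hz)
    · exact fun z hz => div_ne_zero
        (zpow_ne_zero _ (div_ne_zero (hp0 z hz) (hq0 z hz))) (zpow_ne_zero _ (hq0 z hz))
    · intro z hz
      rw [hFe z hz, div_zpow (z - q)]
      rw [div_div_eq_mul_div]
      ring

/-- An arc closed up by a path outside an open set `C` separates `C`. -/
theorem not_isPreconnected_diff_arc {C : Set ℂ} (hC : IsOpen C) {e : ℝ → ℂ}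
    (he : ContinuousOn e (Icc 0 1)) (hne : e 0 ≠ e 1) (γ : Path (e 0) (e 1))
    (hγ : Disjoint C (range γ)) (heC : e '' Ioo 0 1 ⊆ C) :
    ¬ IsPreconnected (C \ e '' Icc 0 1) := by
  intro hpre
  have hecl : IsClosed (e '' Icc 0 1) := (isCompact_Icc.image_of_continuousOn he).isClosed
  let δ : Path (e 0) (e 1) :=
    { toFun := fun t => e t
      continuous_toFun := continuousOn_iff_continuous_domRestrict.1 he
      source' := by simp
      target' := by simp }
  have hδ : range δ = e '' Icc 0 1 := by
    ext z
    constructor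
    · rintro ⟨t, rfl⟩; exact ⟨t, t.2, rfl⟩
    · rintro ⟨t, ht, rfl⟩; exact ⟨⟨t, ht⟩, rfl⟩
  obtain ⟨L, hL, hLe⟩ := hasLogOn_compl_path δ
  rw [hδ] at hL hLe
  obtain ⟨M, hM, hMe⟩ := hasLogOn_compl_path γ
  have hCγ : C ⊆ (range γ)ᶜ := fun z hz hzγ => disjoint_left.1 hγ hz hzγ
  obtain ⟨n, hn⟩ := logs_differ_by_const hpre (f := L) (g := M) (hL.mono fun z hz => hz.2)
    (hM.mono fun z hz => hCγ hz.1)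
    (fun z hz => (hLe z hz.2).trans (hMe z (hCγ hz.1)).symm)
  obtain ⟨F, hF, hF1, hF2⟩ := exists_glue_open hC hecl.isOpen_compl
    (f := fun z => M z + n * (2 * Real.pi * Complex.I)) (g := L)
    ((hM.mono hCγ).add continuousOn_const) hL
    (fun z hz hz' => (hn z ⟨hz, hz'⟩).symm)
  have hsub : ({e 0, e 1} : Set ℂ)ᶜ ⊆ C ∪ (e '' Icc 0 1)ᶜ := by
    intro z hz
    by_cases hze : z ∈ e '' Icc 0 1
    · left
      obtain ⟨t, ht, rfl⟩ := hze
      refine heC ⟨t, ⟨lt_of_le_of_ne ht.1 ?_, lt_of_le_of_ne ht.2 ?_⟩, rfl⟩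
      · rintro rfl; simp at hz
      · rintro rfl; simp at hz
    · exact Or.inr hze
  refine not_hasLogOn_compl_pair hne ⟨F, hF.mono hsub, fun z hz => ?_⟩
  rcases hsub hz with h | h
  · rw [hF1 h]
    simp only
    rw [Complex.exp_add, exp_int_mul_two_pi, mul_one, hMe z (hCγ h)]
  · rw [hF2 h, hLe z h]

end PlaneTopology

end

section

open Set Topology

/-- The setoid on `α` generated by the edges in `S` of the multigraph with end maps `a`, `b`. -/
def EdgeConn {α E : Type*} (a b : E → α) (S : Set E) : Setoid α :=
  Relation.EqvGen.setoid fun x y => ∃ e ∈ S, a e = x ∧ b e = y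

namespace EdgeConn

variable {α E : Type*} {a b : E → α} {S T : Set E}

theorem edge {e : E} (he : e ∈ S) : EdgeConn a b S (a e) (b e) :=
  Relation.EqvGen.rel _ _ ⟨e, he, rfl, rfl⟩

theorem mem_of_edges {r : Setoid α} (h : ∀ e ∈ S, r (a e) (b e)) {x y : α}
    (hxy : EdgeConn a b S x y) : r x y := by
  have : EdgeConn a b S ≤ r := Setoid.eqvGen_le (by rintro _ _ ⟨e, he, rfl, rfl⟩; exact h e he)
  exact this hxy

theorem mono (h : S ⊆ T) {x y : α} (hxy : EdgeConn a b S x y) : EdgeConn a b T x y :=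
  mem_of_edges (fun _ he => edge (h he)) hxy

/-- A set that is a union of classes stays closed under connection. -/
theorem mem_of_closed {P : α → Prop} (h : ∀ e ∈ S, P (a e) ↔ P (b e)) {x y : α}
    (hxy : EdgeConn a b S x y) : P x ↔ P y :=
  mem_of_edges (r := ⟨fun x y => P x ↔ P y, fun _ => Iff.rfl, Iff.symm, Iff.trans⟩) h hxy

end EdgeConn

/-- A finite multigraph drawn in the complex plane without crossings. -/
structure PlaneGraph (V E : Type*) where
  pos : V → ℂ
  arc : E → ℝ → ℂ
  src : E → V
  tgt : E → V
  pos_inj : Function.Injective pos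
  arc_cont : ∀ e, ContinuousOn (arc e) (Icc 0 1)
  arc_inj : ∀ e, InjOn (arc e) (Icc 0 1)
  arc_zero : ∀ e, arc e 0 = pos (src e)
  arc_one : ∀ e, arc e 1 = pos (tgt e)
  arc_avoid : ∀ e, ∀ t ∈ Ioo (0 : ℝ) 1, ∀ x, arc e t ≠ pos x
  arc_disj : ∀ e e', e ≠ e' → ∀ s ∈ Ioo (0 : ℝ) 1, ∀ t ∈ Ioo (0 : ℝ) 1, arc e s ≠ arc e' t

namespace PlaneGraph

open PlaneTopology

variable {V E : Type*} (P : PlaneGraph V E)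

/-- The closed arc of an edge. -/
def edgeSet (e : E) : Set ℂ := P.arc e '' Icc 0 1

/-- The point set of the spanning subgraph with edge set `S`. -/
def img (S : Set E) : Set ℂ := range P.pos ∪ ⋃ e ∈ S, P.edgeSet e

/-- The component of the complement of the subgraph `S` that contains `p`. -/
def comp (S : Set E) (p : ℂ) : Set ℂ := connectedComponentIn (P.img S)ᶜ p

/-- An interior point of an edge. -/
noncomputable def mid (e : E) : ℂ := P.arc e (1 / 2)

/-- The faces of the drawing. -/
def Face : Type _ := {C : Set ℂ // ∃ p ∉ P.img univ, C = P.comp univ p}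

variable {P}

theorem isCompact_edgeSet (e : E) : IsCompact (P.edgeSet e) :=
  isCompact_Icc.image_of_continuousOn (P.arc_cont e)

theorem hasLogs_edgeSet (e : E) : HasLogs (P.edgeSet e) :=
  hasLogs_arc zero_le_one (P.arc_cont e) (P.arc_inj e)

theorem img_insert (e : E) (S : Set E) : P.img (insert e S) = P.img S ∪ P.edgeSet e := by
  unfold img
  rw [biUnion_insert, union_comm (P.edgeSet e), union_assoc]

theorem img_mono {S T : Set E} (h : S ⊆ T) : P.img S ⊆ P.img T :=
  union_subset_union_right _ (biUnion_subset_biUnion_left h)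

theorem isCompact_img [Finite V] [Finite E] (S : Set E) : IsCompact (P.img S) :=
  (finite_range P.pos).isCompact.union (S.toFinite.isCompact_biUnion fun e _ => isCompact_edgeSet e)

theorem isOpen_comp [Finite V] [Finite E] (S : Set E) (p : ℂ) : IsOpen (P.comp S p) :=
  (isCompact_img S).isClosed.isOpen_compl.connectedComponentIn

theorem pos_mem_img (S : Set E) (v : V) : P.pos v ∈ P.img S := Or.inl ⟨v, rfl⟩

theorem edgeSet_subset_img {S : Set E} {e : E} (he : e ∈ S) : P.edgeSet e ⊆ P.img S :=
  (subset_biUnion_of_mem he).trans subset_union_right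

theorem comp_subset {S : Set E} {p : ℂ} : P.comp S p ⊆ (P.img S)ᶜ := connectedComponentIn_subset _ _

theorem mem_comp_self {S : Set E} {p : ℂ} (hp : p ∉ P.img S) : p ∈ P.comp S p :=
  mem_connectedComponentIn hp

theorem comp_eq {S : Set E} {p q : ℂ} (h : q ∈ P.comp S p) : P.comp S p = P.comp S q :=
  connectedComponentIn_eq h

theorem notMem_of_mem_comp {S : Set E} {p q : ℂ} (h : q ∈ P.comp S p) : p ∉ P.img S := fun hp => by
  rw [comp, connectedComponentIn_eq_empty (by simpa using hp)] at h
  exact h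

theorem mem_comp_symm {S : Set E} {p q : ℂ} (h : q ∈ P.comp S p) : p ∈ P.comp S q := by
  rw [← comp_eq h]
  exact mem_comp_self (notMem_of_mem_comp h)

theorem mem_comp_trans {S : Set E} {p q r : ℂ} (h : q ∈ P.comp S p) (h' : r ∈ P.comp S q) :
    r ∈ P.comp S p := by
  rwa [comp_eq h]

theorem comp_anti {S T : Set E} (h : S ⊆ T) {p : ℂ} : P.comp T p ⊆ P.comp S p :=
  connectedComponentIn_mono _ (compl_subset_compl.2 (img_mono h))

theorem edgeSet_cases {e : E} {z : ℂ} (h : z ∈ P.edgeSet e) :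
    z = P.pos (P.src e) ∨ z = P.pos (P.tgt e) ∨ ∃ t ∈ Ioo (0 : ℝ) 1, P.arc e t = z := by
  obtain ⟨t, ht, rfl⟩ := h
  rcases eq_or_ne t 0 with rfl | h0
  · exact Or.inl (P.arc_zero e)
  rcases eq_or_ne t 1 with rfl | h1
  · exact Or.inr (Or.inl (P.arc_one e))
  · exact Or.inr (Or.inr ⟨t, ⟨lt_of_le_of_ne ht.1 h0.symm, lt_of_le_of_ne ht.2 h1⟩, rfl⟩)

theorem src_mem (e : E) : P.pos (P.src e) ∈ P.edgeSet e := ⟨0, by simp, P.arc_zero e⟩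

theorem tgt_mem (e : E) : P.pos (P.tgt e) ∈ P.edgeSet e := ⟨1, by simp, P.arc_one e⟩

theorem arc_notMem_edgeSet {e e' : E} (he : e ≠ e') {t : ℝ} (ht : t ∈ Ioo (0 : ℝ) 1) :
    P.arc e t ∉ P.edgeSet e' := fun h => by
  rcases edgeSet_cases h with h | h | ⟨s, hs, h⟩
  · exact P.arc_avoid e t ht _ h
  · exact P.arc_avoid e t ht _ h
  · exact P.arc_disj e e' he t ht s hs h.symm

theorem arc_notMem_img {S : Set E} {e : E} (he : e ∉ S) {t : ℝ} (ht : t ∈ Ioo (0 : ℝ) 1) :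
    P.arc e t ∉ P.img S := by
  rintro (⟨x, hx⟩ | h)
  · exact P.arc_avoid e t ht x hx.symm
  · simp only [mem_iUnion] at h
    obtain ⟨e', he', h⟩ := h
    exact arc_notMem_edgeSet (by rintro rfl; exact he he') ht h

theorem half_mem : (1 / 2 : ℝ) ∈ Ioo (0 : ℝ) 1 := by constructor <;> norm_num

theorem mid_notMem_img {S : Set E} {e : E} (he : e ∉ S) : P.mid e ∉ P.img S :=
  arc_notMem_img he half_mem

theorem arc_mem_comp_mid {S : Set E} {e : E} (he : e ∉ S) {t : ℝ} (ht : t ∈ Ioo (0 : ℝ) 1) :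
    P.arc e t ∈ P.comp S (P.mid e) := by
  refine (isPreconnected_Ioo.image _ ((P.arc_cont e).mono Ioo_subset_Icc_self)
    ).subset_connectedComponentIn ⟨1 / 2, half_mem, rfl⟩ ?_ ⟨t, ht, rfl⟩
  rintro _ ⟨s, hs, rfl⟩
  exact arc_notMem_img he hs

theorem img_inter_edgeSet {S : Set E} {e : E} (he : e ∉ S) :
    P.img S ∩ P.edgeSet e ⊆ {P.pos (P.src e), P.pos (P.tgt e)} := by
  rintro z ⟨hz, hze⟩
  rcases edgeSet_cases hze with h | h | ⟨t, ht, rfl⟩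
  · exact Or.inl h
  · exact Or.inr h
  · exact absurd hz (arc_notMem_img he ht)

theorem img_inter_subarc {S : Set E} {e : E} (he : e ∉ S) {s : Set ℝ} (hs : s ⊆ Icc 0 1)
    (hs' : 0 ∉ s ∨ 1 ∉ s) : (P.img S ∩ P.arc e '' s).Subsingleton := by
  have key : ∀ t ∈ s, P.arc e t ∈ P.img S → t = 0 ∨ t = 1 := by
    intro t ht h
    by_contra hcon
    rw [not_or] at hcon
    exact arc_notMem_img he ⟨lt_of_le_of_ne (hs ht).1 (Ne.symm hcon.1),
      lt_of_le_of_ne (hs ht).2 hcon.2⟩ h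
  rintro _ ⟨hx, t, ht, rfl⟩ _ ⟨hy, t', ht', rfl⟩
  rcases key t ht hx with rfl | rfl <;> rcases key t' ht' hy with rfl | rfl <;> tauto

/-- A side of an edge has the whole edge on its boundary. -/
theorem arc_mem_closure_comp [Finite V] [Finite E] {S : Set E} {e : E} (he : e ∉ S) {p : ℂ}
    (hp : p ∉ P.img (insert e S)) (hpe : p ∈ P.comp S (P.mid e)) {t : ℝ}
    (ht : t ∈ Ioo (0 : ℝ) 1) : P.arc e t ∈ closure (P.comp (insert e S) p) := by
  by_contra hcon
  have hcont : ContinuousAt (P.arc e) t :=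
    (P.arc_cont e).continuousAt (mem_nhds_iff.2 ⟨_, Ioo_subset_Icc_self, isOpen_Ioo, ht⟩)
  have hnh : P.arc e ⁻¹' (closure (P.comp (insert e S) p))ᶜ ∩ Ioo 0 1 ∈ 𝓝 t :=
    Filter.inter_mem (hcont (isClosed_closure.isOpen_compl.mem_nhds hcon)) (isOpen_Ioo.mem_nhds ht)
  obtain ⟨a, b, hab, hnb, hsub⟩ := exists_Icc_mem_subset_of_mem_nhds hnh
  have hab' := Icc_mem_nhds_iff.1 hnb
  have ha := (hsub (left_mem_Icc.2 (hab'.1.le.trans hab'.2.le))).2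
  have hb := (hsub (right_mem_Icc.2 (hab'.1.le.trans hab'.2.le))).2
  have s1 : Icc 0 a ⊆ Icc (0 : ℝ) 1 := Icc_subset_Icc_right ha.2.le
  have s2 : Icc b 1 ⊆ Icc (0 : ℝ) 1 := Icc_subset_Icc_left hb.1.le
  have c1 := (P.arc_cont e).mono s1
  have c2 := (P.arc_cont e).mono s2
  have k1 : IsCompact (P.arc e '' Icc 0 a) := isCompact_Icc.image_of_continuousOn c1
  have k2 : IsCompact (P.arc e '' Icc b 1) := isCompact_Icc.image_of_continuousOn c2
  rw [img_insert, mem_union, not_or] at hp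
  have hps : ∀ s : Set ℝ, s ⊆ Icc 0 1 → p ∉ P.arc e '' s := fun s hs h => hp.2 (image_mono hs h)
  have hts : ∀ s : Set ℝ, s ⊆ Icc 0 1 → t ∉ s → P.arc e t ∉ P.arc e '' s := by
    rintro s hs hts ⟨t', ht', h⟩
    exact hts (P.arc_inj e (hs ht') (Ioo_subset_Icc_self ht) h ▸ ht')
  have ht1 : t ∉ Icc 0 a := fun h => absurd h.2 (not_le.2 hab'.1)
  have ht2 : t ∉ Icc b 1 := fun h => absurd h.1 (not_le.2 hab'.2)
  have htS : P.arc e t ∉ P.img S := arc_notMem_img he ht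
  have e1 : P.arc e t ∈ connectedComponentIn (P.img S ∪ ∅ ∪ P.arc e '' Icc 0 a)ᶜ p := by
    refine mem_component_union_arc (isCompact_img S) isCompact_empty (disjoint_empty _) k1
      (hasLogs_arc ha.1.le c1 ((P.arc_inj e).mono s1))
      (img_inter_subarc he s1 (Or.inr fun h => absurd h.2 (not_le.2 ha.2))) (by simp) ?_ ?_ ?_
    · simp only [union_empty, mem_union, not_or]; exact ⟨hp.1, hps _ s1⟩
    · simp only [union_empty, mem_union, not_or]; exact ⟨htS, hts _ s1 ht1⟩
    · rw [union_empty]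
      exact mem_comp_trans (mem_comp_symm hpe) (arc_mem_comp_mid he ht)
  rw [union_empty] at e1
  have e2 : P.arc e t ∈
      connectedComponentIn (P.img S ∪ P.arc e '' Icc 0 a ∪ ∅ ∪ P.arc e '' Icc b 1)ᶜ p := by
    refine mem_component_union_arc ((isCompact_img S).union k1) isCompact_empty (disjoint_empty _) k2
      (hasLogs_arc hb.2.le c2 ((P.arc_inj e).mono s2)) ?_ (by simp) ?_ ?_ (by rwa [union_empty])
    · refine (img_inter_subarc (P := P) he s2 (Or.inl fun h => absurd h.1 (not_le.2 hb.1))).anti ?_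
      rintro z ⟨hz | ⟨u, hu, rfl⟩, hz'⟩
      · exact ⟨hz, hz'⟩
      · obtain ⟨v, hv, hvu⟩ := hz'
        have := P.arc_inj e (s2 hv) (s1 hu) hvu
        have h1 := hu.2
        have h2 := hv.1
        linarith [hab'.1, hab'.2]
    · simp only [union_empty, mem_union, not_or]; exact ⟨⟨hp.1, hps _ s1⟩, hps _ s2⟩
    · simp only [union_empty, mem_union, not_or]; exact ⟨⟨htS, hts _ s1 ht1⟩, hts _ s2 ht2⟩
  rw [union_empty] at e2
  set Q := connectedComponentIn (P.img S ∪ P.arc e '' Icc 0 a ∪ P.arc e '' Icc b 1)ᶜ p with hQ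
  have hpi : p ∉ P.img (insert e S) := by rw [img_insert, mem_union, not_or]; exact hp
  have hpQ : p ∈ Q := mem_connectedComponentIn (by
    simp only [mem_compl_iff, mem_union, not_or]; exact ⟨⟨hp.1, hps _ s1⟩, hps _ s2⟩)
  have hQs : Q ⊆ P.comp (insert e S) p := by
    refine isPreconnected_connectedComponentIn.subset_of_closure_inter_subset (isOpen_comp _ _)
      ⟨p, hpQ, mem_comp_self hpi⟩ ?_
    rintro z ⟨hz, hzQ⟩
    rcases closure_component_subset hz with h | h
    · exfalso
      have hzQ' := connectedComponentIn_subset _ _ hzQ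
      simp only [mem_compl_iff, mem_union, not_or] at hzQ'
      rw [img_insert] at h
      rcases h with h | ⟨u, hu, rfl⟩
      · exact hzQ'.1.1 h
      · have hua : a < u := by
          by_contra h; exact hzQ'.1.2 ⟨u, ⟨hu.1, not_lt.1 h⟩, rfl⟩
        have hub : u < b := by
          by_contra h; exact hzQ'.2 ⟨u, ⟨not_lt.1 h, hu.2⟩, rfl⟩
        exact (hsub ⟨hua.le, hub.le⟩).1 hz
    · exact h
  exact hcon (subset_closure (hQs e2))

/-- At most two components of the complement lie along an edge. -/
theorem three_points [Finite V] [Finite E] {S : Set E} {e : E} (he : e ∉ S) {p q r : ℂ}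
    (hp : p ∉ P.img (insert e S)) (hq : q ∉ P.img (insert e S)) (hr : r ∉ P.img (insert e S))
    (hpq : q ∈ P.comp S p) (hqr : r ∈ P.comp S q) :
    q ∈ P.comp (insert e S) p ∨ r ∈ P.comp (insert e S) q ∨ r ∈ P.comp (insert e S) p := by
  unfold comp
  rw [img_insert] at *
  exact three_points_arc (isCompact_img S) (isCompact_edgeSet e) (hasLogs_edgeSet e)
    ⟨pos_mem_img _ _, src_mem e⟩ ⟨pos_mem_img _ _, tgt_mem e⟩ (img_inter_edgeSet he) hp hq hr hpq hqr

theorem joinedIn_of_edgeConn {S : Set E} {u v : V} (h : EdgeConn P.src P.tgt S u v) :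
    JoinedIn (P.img S) (P.pos u) (P.pos v) := by
  refine EdgeConn.mem_of_edges (r := ⟨fun u v => JoinedIn (P.img S) (P.pos u) (P.pos v),
    fun u => JoinedIn.refl (pos_mem_img _ _), JoinedIn.symm, JoinedIn.trans⟩) ?_ h
  intro e he
  show JoinedIn _ _ _
  have hpc : IsPathConnected (P.edgeSet e) :=
    ((convex_Icc (0 : ℝ) 1).isPathConnected ⟨0, by simp⟩).image' (P.arc_cont e)
  exact (hpc.joinedIn _ (src_mem e) _ (tgt_mem e)).mono (edgeSet_subset_img he)

theorem mem_comp_mid_diff {S : Set E} {e : E} {p : ℂ} :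
    p ∈ P.comp S (P.mid e) \ P.edgeSet e → p ∉ P.img (insert e S) := by
  rintro ⟨h1, h2⟩ h
  rw [img_insert] at h
  exact h.elim (comp_subset h1) h2

/-- An edge closing a cycle separates. -/
theorem exists_separated {S : Set E} [Finite V] [Finite E] {e : E} (he : e ∉ S)
    (h : EdgeConn P.src P.tgt S (P.src e) (P.tgt e)) :
    ∃ p ∈ P.comp S (P.mid e) \ P.edgeSet e, ∃ q ∈ P.comp S (P.mid e) \ P.edgeSet e,
      q ∉ P.comp (insert e S) p := by
  by_contra! hcon
  have hj := joinedIn_of_edgeConn h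
  rw [← P.arc_zero, ← P.arc_one] at hj
  refine not_isPreconnected_diff_arc (isOpen_comp (P := P) S (P.mid e)) (P.arc_cont e) ?_ hj.somePath ?_ ?_ ?_
  · intro h
    have := P.arc_inj e (by simp) (by simp) h
    norm_num at this
  · rw [disjoint_left]
    rintro z hz ⟨t, rfl⟩
    exact comp_subset hz (hj.somePath_mem t)
  · rintro _ ⟨t, ht, rfl⟩
    exact arc_mem_comp_mid he ht
  · rcases (P.comp S (P.mid e) \ P.edgeSet e).eq_empty_or_nonempty with h0 | ⟨p, hp⟩
    · change IsPreconnected (P.comp S (P.mid e) \ P.edgeSet e)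
      rw [h0]; exact isPreconnected_empty
    · have : P.comp S (P.mid e) \ P.edgeSet e = P.comp (insert e S) p := by
        refine subset_antisymm (fun q hq => hcon p hp q hq) fun q hq => ⟨?_, fun hqe => ?_⟩
        · exact mem_comp_trans hp.1 (comp_anti (subset_insert _ _) hq)
        · exact comp_subset hq (edgeSet_subset_img (mem_insert _ _) hqe)
      change IsPreconnected (P.comp S (P.mid e) \ P.edgeSet e)
      rw [this]
      exact isPreconnected_connectedComponentIn

/-- An edge joining different components does not separate. -/
theorem mem_comp_of_not_edgeConn {S : Set E} [Finite V] [Finite E] {e : E} (he : e ∉ S)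
    (h : ¬ EdgeConn P.src P.tgt S (P.src e) (P.tgt e)) {p q : ℂ}
    (hp : p ∈ P.comp S (P.mid e) \ P.edgeSet e) (hq : q ∈ P.comp S (P.mid e) \ P.edgeSet e) :
    q ∈ P.comp (insert e S) p := by
  set R : V → Prop := fun v => EdgeConn P.src P.tgt S (P.src e) v
  have hR : ∀ e' ∈ S, (R (P.src e') ↔ R (P.tgt e')) := fun e' he' =>
    ⟨fun h => Setoid.trans' _ h (EdgeConn.edge he'),
      fun h => Setoid.trans' _ h (Setoid.symm' _ (EdgeConn.edge he'))⟩
  let K : (V → Prop) → Set ℂ := fun R =>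
    (P.pos '' {v | R v}) ∪ ⋃ e' ∈ {e' | e' ∈ S ∧ R (P.src e')}, P.edgeSet e'
  have hK : ∀ R, IsCompact (K R) := fun R =>
    ((toFinite _).image P.pos).isCompact.union
      ((toFinite _).isCompact_biUnion fun e _ => isCompact_edgeSet e)
  have hKK : K R ∪ K (fun v => ¬ R v) = P.img S := by
    apply subset_antisymm
    · refine union_subset (union_subset ?_ ?_) (union_subset ?_ ?_)
      · rintro _ ⟨v, -, rfl⟩; exact pos_mem_img _ _
      · exact iUnion₂_subset fun e' he' => edgeSet_subset_img he'.1
      · rintro _ ⟨v, -, rfl⟩; exact pos_mem_img _ _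
      · exact iUnion₂_subset fun e' he' => edgeSet_subset_img he'.1
    · refine union_subset ?_ (iUnion₂_subset fun e' he' => ?_)
      · rintro _ ⟨v, rfl⟩
        by_cases hv : R v
        · exact Or.inl (Or.inl ⟨v, hv, rfl⟩)
        · exact Or.inr (Or.inl ⟨v, hv, rfl⟩)
      · by_cases hv : R (P.src e')
        · exact (subset_biUnion_of_mem (u := P.edgeSet) (s := {e' | e' ∈ S ∧ R (P.src e')})
            ⟨he', hv⟩).trans (subset_union_right.trans subset_union_left)
        · exact (subset_biUnion_of_mem (u := P.edgeSet) (s := {e' | e' ∈ S ∧ ¬ R (P.src e')})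
            ⟨he', hv⟩).trans (subset_union_right.trans subset_union_right)
  have hcase : ∀ R : V → Prop, (∀ e' ∈ S, (R (P.src e') ↔ R (P.tgt e'))) → ∀ z ∈ K R,
      (∃ v, R v ∧ z = P.pos v) ∨ ∃ e' ∈ S, R (P.src e') ∧ ∃ t ∈ Ioo (0 : ℝ) 1, P.arc e' t = z := by
    rintro R hR z (⟨v, hv, rfl⟩ | hz)
    · exact Or.inl ⟨v, hv, rfl⟩
    · simp only [mem_iUnion] at hz
      obtain ⟨e', ⟨he', hv⟩, hz⟩ := hz
      rcases edgeSet_cases hz with h | h | h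
      · exact Or.inl ⟨_, hv, h⟩
      · exact Or.inl ⟨_, (hR e' he').1 hv, h⟩
      · exact Or.inr ⟨e', he', hv, h⟩
  have hR' : ∀ e' ∈ S, (¬ R (P.src e') ↔ ¬ R (P.tgt e')) := fun e' he' => not_congr (hR e' he')
  have hdis : Disjoint (K R) (K fun v => ¬ R v) := by
    rw [disjoint_left]
    intro z hz hz'
    rcases hcase R hR z hz with ⟨v, hv, rfl⟩ | ⟨e', he', hv, t, ht, rfl⟩ <;>
    rcases hcase _ hR' _ hz' with ⟨w, hw, hh⟩ | ⟨e'', he'', hw, s, hs, hh⟩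
    · exact hw (P.pos_inj hh ▸ hv)
    · exact P.arc_avoid _ _ hs _ hh
    · exact P.arc_avoid _ _ ht _ hh
    · rcases eq_or_ne e'' e' with rfl | hne
      · exact hw hv
      · exact P.arc_disj _ _ hne _ hs _ ht hh
  have hend : ∀ R : V → Prop, (∀ e' ∈ S, (R (P.src e') ↔ R (P.tgt e'))) →
      ¬ (R (P.src e) ∧ R (P.tgt e)) → (K R ∩ P.edgeSet e).Subsingleton := by
    intro R hR hRe
    have : ∀ z ∈ K R ∩ P.edgeSet e, (z = P.pos (P.src e) ∧ R (P.src e)) ∨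
        (z = P.pos (P.tgt e) ∧ R (P.tgt e)) := by
      rintro z ⟨hz, hze⟩
      rcases edgeSet_cases hze with rfl | rfl | ⟨t, ht, rfl⟩ <;>
      rcases hcase R hR _ hz with ⟨v, hv, hh⟩ | ⟨e', he', hv, s, hs, hh⟩
      · exact Or.inl ⟨rfl, P.pos_inj hh ▸ hv⟩
      · exact absurd hh (P.arc_avoid _ _ hs _)
      · exact Or.inr ⟨rfl, P.pos_inj hh ▸ hv⟩
      · exact absurd hh (P.arc_avoid _ _ hs _)
      · exact absurd hh (P.arc_avoid _ _ ht _)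
      · exact absurd hh (P.arc_disj _ _ (by rintro rfl; exact he he') _ hs _ ht)
    intro x hx y hy
    rcases this x hx with ⟨h1, h2⟩ | ⟨h1, h2⟩ <;> rcases this y hy with ⟨h3, h4⟩ | ⟨h3, h4⟩
    · rw [h1, h3]
    · exact absurd ⟨h2, h4⟩ hRe
    · exact absurd ⟨h4, h2⟩ hRe
    · rw [h1, h3]
  have hRs : R (P.src e) := Setoid.refl' _ _
  have hpq : q ∈ connectedComponentIn (P.img S)ᶜ p := mem_comp_trans (mem_comp_symm hp.1) hq.1
  have hp' := mem_comp_mid_diff hp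
  have hq' := mem_comp_mid_diff hq
  unfold comp
  rw [img_insert, ← hKK] at *
  exact mem_component_union_arc (hK _) (hK _) hdis (isCompact_edgeSet e) (hasLogs_edgeSet e)
    (hend R hR fun h' => h h'.2) (hend _ hR' fun h' => h'.1 hRs) hp' hq'
    (by rw [hKK]; exact hpq)

end PlaneGraph

end

section

open Set Topology

namespace PlaneGraph

open PlaneTopology

variable {V E : Type*} {P : PlaneGraph V E}

theorem insert_compl_self (e : E) : insert e ({e}ᶜ : Set E) = univ := by
  rw [insert_eq, union_compl_self]

/-- The face that contains a given point. -/
def faceOf (p : ℂ) (hp : p ∉ P.img univ) : P.Face := ⟨P.comp univ p, p, hp, rfl⟩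

theorem faceOf_eq_iff {p q : ℂ} (hp : p ∉ P.img univ) (hq : q ∉ P.img univ) :
    faceOf p hp = faceOf q hq ↔ q ∈ P.comp univ p := by
  refine ⟨fun h => ?_, fun h => Subtype.ext (comp_eq h)⟩
  have : P.comp univ p = P.comp univ q := congrArg Subtype.val h
  rw [this]
  exact mem_comp_self hq

theorem exists_faceOf (f : P.Face) : ∃ p hp, f = faceOf p hp := by
  obtain ⟨C, p, hp, h⟩ := f
  exact ⟨p, hp, Subtype.ext h⟩

theorem notMem_img_univ {e : E} {p : ℂ} (hp : p ∈ P.comp {e}ᶜ (P.mid e) \ P.edgeSet e) :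
    p ∉ P.img univ := by
  have := mem_comp_mid_diff hp
  rwa [insert_compl_self] at this

variable (P) in
/-- `l` and `r` choose the faces on the two sides of each edge. -/
def SideFaces (l r : E → P.Face) : Prop :=
  ∀ e, l e ≠ r e ∧ ∀ p (hp : p ∉ P.img univ),
    p ∈ P.comp {e}ᶜ (P.mid e) ↔ (l e = faceOf p hp ∨ r e = faceOf p hp)

theorem exists_sideFaces [Finite V] [Finite E]
    (hB : ∀ e, EdgeConn P.src P.tgt {e}ᶜ (P.src e) (P.tgt e)) :
    ∃ l r, P.SideFaces l r := by
  have : ∀ e, ∃ l r : P.Face, l ≠ r ∧ ∀ p (hp : p ∉ P.img univ),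
      p ∈ P.comp {e}ᶜ (P.mid e) ↔ (l = faceOf p hp ∨ r = faceOf p hp) := by
    intro e
    have he : e ∉ ({e}ᶜ : Set E) := by simp
    obtain ⟨p, hp, q, hq, hpq⟩ := exists_separated he (hB e)
    have hp' := notMem_img_univ hp
    have hq' := notMem_img_univ hq
    rw [insert_compl_self] at hpq
    refine ⟨faceOf p hp', faceOf q hq', ?_, fun x hx => ?_⟩
    · rwa [Ne, faceOf_eq_iff]
    · rw [faceOf_eq_iff, faceOf_eq_iff]
      constructor
      · intro hxe
        have h3 := three_points (P := P) he (p := p) (q := q) (r := x)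
        rw [insert_compl_self] at h3
        have := h3 hp' hq' hx (mem_comp_trans (mem_comp_symm hp.1) hq.1)
          (mem_comp_trans (mem_comp_symm hq.1) hxe)
        tauto
      · rintro (h | h)
        · exact mem_comp_trans hp.1 (comp_anti (subset_univ _) h)
        · exact mem_comp_trans hq.1 (comp_anti (subset_univ _) h)
  choose l r h using this
  exact ⟨l, r, h⟩

variable {l r : E → P.Face}

theorem side_mem (hlr : P.SideFaces l r) {e : E} {p : ℂ} (hp : p ∉ P.img univ)
    (h : l e = faceOf p hp ∨ r e = faceOf p hp) : p ∈ P.comp {e}ᶜ (P.mid e) :=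
  ((hlr e).2 p hp).2 h

theorem comp_compl_singleton_subset {S : Set E} {e : E} (he : e ∉ S) {p : ℂ} :
    P.comp {e}ᶜ p ⊆ P.comp S p := comp_anti (by rintro x hx rfl; exact he hx)

/-- Every component lying along `e` contains one of the two faces along `e`. -/
theorem exists_side_face [Finite V] [Finite E] (hlr : P.SideFaces l r) {S : Set E} {e : E}
    (he : e ∉ S) {p : ℂ}
    (hp : p ∉ P.img (insert e S)) (hpe : p ∈ P.comp S (P.mid e)) :
    ∃ x hx, x ∈ P.comp (insert e S) p ∧ (l e = faceOf x hx ∨ r e = faceOf x hx) := by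
  have h1 := arc_mem_closure_comp he hp hpe half_mem
  have hme : e ∉ ({e}ᶜ : Set E) := by simp
  obtain ⟨x, hx1, hx2⟩ := mem_closure_iff.1 h1 _ (isOpen_comp {e}ᶜ (P.mid e))
    (mem_comp_self (mid_notMem_img hme))
  have hx : x ∉ P.img univ := notMem_img_univ ⟨hx1, fun h =>
    comp_subset hx2 (edgeSet_subset_img (mem_insert _ _) h)⟩
  exact ⟨x, hx, hx2, ((hlr e).2 x hx).1 hx1⟩

theorem mem_comp_of_edgeConn (hlr : P.SideFaces l r) {S : Set E} {p q : ℂ}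
    (hp : p ∉ P.img univ) (hq : q ∉ P.img univ)
    (h : EdgeConn l r Sᶜ (faceOf p hp) (faceOf q hq)) : q ∈ P.comp S p := by
  have hS : ∀ {x}, x ∉ P.img univ → x ∉ P.img S := fun hx h => hx (img_mono (subset_univ _) h)
  have key := EdgeConn.mem_of_edges (r := ⟨fun f g : P.Face => ∀ p hp q hq, f = faceOf p hp →
      g = faceOf q hq → q ∈ P.comp S p, ?_, ?_, ?_⟩) ?_ h
  · exact key p hp q hq rfl rfl
  · intro f p hp q hq h1 h2
    exact comp_anti (subset_univ _) ((faceOf_eq_iff hp hq).1 (h1.symm.trans h2))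
  · intro f g h p hp q hq h1 h2
    exact mem_comp_symm (h q hq p hp h2 h1)
  · intro f g k h h' p hp q hq h1 h2
    obtain ⟨x, hx, hgx⟩ := exists_faceOf g
    exact mem_comp_trans (h p hp x hx h1 hgx) (h' x hx q hq hgx h2)
  · intro e he p hp q hq h1 h2
    have h3 := side_mem hlr hp (Or.inl h1)
    have h4 := side_mem hlr hq (Or.inr h2)
    exact comp_compl_singleton_subset (by simpa using he) (mem_comp_trans (mem_comp_symm h3) h4)

theorem comp_eq_of_notMem {S : Set E} {e : E} (he : e ∉ S) {p q : ℂ} (hp : p ∉ P.img S)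
    (hpe : p ∉ P.comp S (P.mid e)) (h : q ∈ P.comp S p) : q ∈ P.comp (insert e S) p := by
  refine isPreconnected_connectedComponentIn.subset_connectedComponentIn (mem_comp_self hp) ?_ h
  intro z hz hz'
  have hzS := comp_subset hz
  rw [img_insert] at hz'
  rcases hz' with hz' | hz'
  · exact hzS hz'
  rcases edgeSet_cases hz' with rfl | rfl | ⟨t, ht, rfl⟩
  · exact hzS (pos_mem_img _ _)
  · exact hzS (pos_mem_img _ _)
  · exact hpe (mem_comp_trans (arc_mem_comp_mid he ht) (mem_comp_symm hz))

theorem edgeConn_side {T : Set E} {e : E} (he : e ∈ T) {f g : P.Face} (hf : l e = f ∨ r e = f)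
    (hg : l e = g ∨ r e = g) : EdgeConn l r T f g := by
  have h : EdgeConn l r T (l e) (r e) := EdgeConn.edge he
  rcases hf with rfl | rfl <;> rcases hg with rfl | rfl
  · exact Setoid.refl' _ _
  · exact h
  · exact Setoid.symm' _ h
  · exact Setoid.refl' _ _

theorem edgeConn_of_mem_comp [Finite V] [Finite E] (hlr : P.SideFaces l r)
    (T : Set E) : ∀ {p q : ℂ} (hp : p ∉ P.img univ)
    (hq : q ∉ P.img univ), q ∈ P.comp Tᶜ p → EdgeConn l r T (faceOf p hp) (faceOf q hq) := by
  induction T, toFinite T using Set.Finite.induction_on with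
  | empty =>
    intro p q hp hq h
    rw [compl_empty] at h
    rw [(faceOf_eq_iff hp hq).2 h]
  | @insert e T heT _ ih =>
    intro p q hp hq h
    set S : Set E := (insert e T)ᶜ with hS
    have he : e ∉ S := by simp [hS]
    have hST : insert e S = Tᶜ := by
      ext x
      simp only [hS, mem_insert_iff, mem_compl_iff, not_or]
      constructor
      · rintro (rfl | h)
        · exact heT
        · exact h.2
      · intro h
        by_cases hx : x = e
        · exact Or.inl hx
        · exact Or.inr ⟨hx, h⟩
    have hSu : ∀ {x S}, x ∉ P.img univ → x ∉ P.img S := fun hx h => hx (img_mono (subset_univ _) h)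
    by_cases hpe : p ∈ P.comp S (P.mid e)
    · obtain ⟨x, hx, hxp, hxe⟩ := exists_side_face hlr he (hSu hp) hpe
      obtain ⟨y, hy, hyq, hye⟩ := exists_side_face hlr he (hSu hq) (mem_comp_trans hpe h)
      rw [hST] at hxp hyq
      exact Setoid.trans' _ (EdgeConn.mono (subset_insert _ _) (ih hp hx hxp))
        (Setoid.trans' _ (edgeConn_side (mem_insert _ _) hxe hye)
          (Setoid.symm' _ (EdgeConn.mono (subset_insert _ _) (ih hq hy hyq))))
    · exact EdgeConn.mono (subset_insert _ _)
        (ih hp hq (hST ▸ comp_eq_of_notMem he (hSu hp) hpe h))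

/-- Plane duality: an edge closes a cycle with `S` iff, in the dual graph, it is a bridge of the
complement of `S`. -/
theorem duality [Finite V] [Finite E] (hlr : P.SideFaces l r) {S : Set E} {e : E}
    (he : e ∉ S) :
    EdgeConn P.src P.tgt S (P.src e) (P.tgt e) ↔ ¬ EdgeConn l r (insert e S)ᶜ (l e) (r e) := by
  obtain ⟨x, hx, hxl⟩ := exists_faceOf (l e)
  obtain ⟨y, hy, hyr⟩ := exists_faceOf (r e)
  have hxe := side_mem hlr hx (Or.inl hxl)
  have hye := side_mem hlr hy (Or.inr hyr)
  have hd : ∀ {z}, z ∉ P.img univ → z ∈ P.comp {e}ᶜ (P.mid e) →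
      z ∈ P.comp S (P.mid e) \ P.edgeSet e := fun hz h =>
    ⟨comp_compl_singleton_subset he h, fun h' => hz (edgeSet_subset_img (mem_univ _) h')⟩
  constructor
  · intro h h'
    obtain ⟨p, hp, q, hq, hpq⟩ := exists_separated he h
    rw [hxl, hyr] at h'
    have hxy := mem_comp_of_edgeConn hlr hx hy h'
    have key : ∀ p ∈ P.comp S (P.mid e) \ P.edgeSet e, p ∈ P.comp (insert e S) x := by
      intro p hp
      obtain ⟨z, hz, hzp, hze⟩ := exists_side_face hlr he (mem_comp_mid_diff hp) hp.1
      rw [hxl, hyr, faceOf_eq_iff, faceOf_eq_iff] at hze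
      refine mem_comp_trans ?_ (mem_comp_symm hzp)
      rcases hze with h | h
      · exact comp_anti (subset_univ _) h
      · exact mem_comp_trans hxy (comp_anti (subset_univ _) h)
    exact hpq (mem_comp_trans (mem_comp_symm (key p hp)) (key q hq))
  · intro h
    by_contra hcon
    refine h ?_
    rw [hxl, hyr]
    refine edgeConn_of_mem_comp hlr _ hx hy ?_
    rw [compl_compl]
    exact mem_comp_of_not_edgeConn he hcon (hd hx hxe) (hd hy hye)

theorem edgeConn_univ [Finite V] [Finite E] (hlr : P.SideFaces l r)
    (f g : P.Face) : EdgeConn l r univ f g := by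
  obtain ⟨p, hp, rfl⟩ := exists_faceOf f
  obtain ⟨q, hq, rfl⟩ := exists_faceOf g
  refine edgeConn_of_mem_comp hlr _ hp hq ?_
  rw [compl_univ]
  have himg : P.img ∅ = range P.pos := by simp [img]
  have hc : IsConnected (P.img ∅)ᶜ := by
    rw [himg]
    exact (finite_range P.pos).countable.isConnected_compl_of_one_lt_rank
      (by rw [Complex.rank_real_complex]; norm_num)
  have hu : ∀ {x}, x ∉ P.img univ → x ∈ (P.img ∅)ᶜ :=
    fun hx h => hx (img_mono (subset_univ _) h)
  exact hc.isPreconnected.subset_connectedComponentIn (hu hp) subset_rfl (hu hq)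

theorem mem_closure_face_iff [Finite V] [Finite E] (hlr : P.SideFaces l r)
    (hdeg : ∀ v, ∃ e, P.src e = v ∨ P.tgt e = v) (v : V) (f : P.Face) :
    P.pos v ∈ closure f.1 ↔ ∃ e, (P.src e = v ∨ P.tgt e = v) ∧ (l e = f ∨ r e = f) := by
  obtain ⟨p, hp, rfl⟩ := exists_faceOf f
  have hclos : ∀ e, (l e = faceOf p hp ∨ r e = faceOf p hp) ↔ ∃ t ∈ Ioo (0 : ℝ) 1,
      P.arc e t ∈ closure (P.comp univ p) := by
    intro e
    have he : e ∉ ({e}ᶜ : Set E) := by simp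
    constructor
    · intro h
      have hpe := side_mem hlr hp h
      have := arc_mem_closure_comp he (p := p) (by rwa [insert_compl_self]) hpe half_mem
      rw [insert_compl_self] at this
      exact ⟨_, half_mem, this⟩
    · rintro ⟨t, ht, h⟩
      obtain ⟨z, hz1, hz2⟩ := mem_closure_iff.1 h _ (isOpen_comp {e}ᶜ (P.mid e))
        (arc_mem_comp_mid he ht)
      exact ((hlr e).2 p hp).1 (mem_comp_trans hz1 (comp_anti (subset_univ _) (mem_comp_symm hz2)))
  change P.pos v ∈ closure (P.comp univ p) ↔ _
  constructor
  · intro hv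
    by_contra hno
    set L : Set ℂ := P.pos '' {v}ᶜ ∪ ⋃ e ∈ {e | ¬(P.src e = v ∨ P.tgt e = v)}, P.edgeSet e with hL
    have hLc : IsClosed L := ((toFinite _).image P.pos).isClosed.union
      (((toFinite _).isCompact_biUnion fun e _ => isCompact_edgeSet e).isClosed)
    have hvL : P.pos v ∉ L := by
      rintro (⟨w, hw, hwv⟩ | h)
      · exact hw (P.pos_inj hwv)
      · simp only [mem_iUnion] at h
        obtain ⟨e, he, h⟩ := h
        rcases edgeSet_cases h with h | h | ⟨t, ht, h⟩
        · exact he (Or.inl (P.pos_inj h).symm)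
        · exact he (Or.inr (P.pos_inj h).symm)
        · exact P.arc_avoid e t ht v h
    obtain ⟨ε, hε, hball⟩ := Metric.isOpen_iff.1 hLc.isOpen_compl _ hvL
    set B : Set ℂ := {z | ‖z - P.pos v‖ ∈ Ioo 0 ε} with hBdef
    have hBpre : IsPreconnected B := isPreconnected_polar _ ordConnected_Ioo fun r hr => hr.1
    have hBball : ∀ z ∈ B, z ∈ Metric.ball (P.pos v) ε := fun z hz => by
      rw [Metric.mem_ball, dist_eq_norm]; exact hz.2
    have hBv : ∀ z ∈ Metric.ball (P.pos v) ε, z ≠ P.pos v → z ∈ B := fun z hz hzv => by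
      rw [Metric.mem_ball, dist_eq_norm] at hz
      exact ⟨norm_pos_iff.2 (sub_ne_zero.2 hzv), hz⟩
    have hBf : B ⊆ P.comp univ p := by
      refine hBpre.subset_of_closure_inter_subset (isOpen_comp _ _) ?_ ?_
      · obtain ⟨z, hz1, hz2⟩ := mem_closure_iff.1 hv _ Metric.isOpen_ball
          (Metric.mem_ball_self hε)
        refine ⟨z, hBv z hz1 ?_, hz2⟩
        rintro rfl
        exact comp_subset hz2 (pos_mem_img _ _)
      · rintro z ⟨hz, hzB⟩
        rcases closure_component_subset hz with h | h
        · exfalso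
          have hzL := hball (hBball z hzB)
          have hzv : z ≠ P.pos v := by
            rintro rfl
            simp [hBdef] at hzB
          rcases h with ⟨w, rfl⟩ | h
          · by_cases hw : w = v
            · exact hzv (by rw [hw])
            · exact hzL (Or.inl ⟨w, hw, rfl⟩)
          · simp only [mem_iUnion] at h
            obtain ⟨e, -, h⟩ := h
            by_cases he : P.src e = v ∨ P.tgt e = v
            · rcases edgeSet_cases h with h' | h' | ⟨t, ht, h'⟩
              · by_cases hw : P.src e = v
                · exact hzv (by rw [h', hw])
                · exact hzL (Or.inl ⟨_, hw, h'.symm⟩)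
              · by_cases hw : P.tgt e = v
                · exact hzv (by rw [h', hw])
                · exact hzL (Or.inl ⟨_, hw, h'.symm⟩)
              · exact hno ⟨e, he, (hclos e).2 ⟨t, ht, by rwa [h']⟩⟩
            · refine hzL (Or.inr ?_)
              simp only [mem_iUnion]
              exact ⟨e, he, h⟩
        · exact h
    obtain ⟨e, he⟩ := hdeg v
    have harc : ∃ t ∈ Ioo (0 : ℝ) 1, P.arc e t ∈ Metric.ball (P.pos v) ε := by
      have hcl : ∀ t ∈ Icc (0 : ℝ) 1, P.arc e t = P.pos v →
          ∃ t ∈ Ioo (0 : ℝ) 1, P.arc e t ∈ Metric.ball (P.pos v) ε := by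
        intro t ht htv
        have h1 : t ∈ closure (Ioo (0 : ℝ) 1) := by rwa [closure_Ioo (by norm_num)]
        have h2 := ((P.arc_cont e) t ht).mono Ioo_subset_Icc_self
        have h3 := h2.mem_closure_image h1
        obtain ⟨z, hz, s, hs, rfl⟩ := mem_closure_iff.1 h3 _ Metric.isOpen_ball
          (by rw [htv]; exact Metric.mem_ball_self hε)
        exact ⟨s, hs, hz⟩
      rcases he with he | he
      · exact hcl 0 (by simp) (by rw [P.arc_zero, he])
      · exact hcl 1 (by simp) (by rw [P.arc_one, he])
    obtain ⟨t, ht, htb⟩ := harc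
    exact comp_subset (hBf (hBv _ htb (P.arc_avoid e t ht v)))
      (edgeSet_subset_img (mem_univ e) ⟨t, Ioo_subset_Icc_self ht, rfl⟩)
  · rintro ⟨e, he, hf⟩
    have hpe := side_mem hlr hp hf
    have hint : ∀ t ∈ Ioo (0 : ℝ) 1, P.arc e t ∈ closure (P.comp univ p) := fun t ht => by
      have := arc_mem_closure_comp (S := {e}ᶜ) (by simp) (p := p) (by rwa [insert_compl_self]) hpe ht
      rwa [insert_compl_self] at this
    have hcl : ∀ t ∈ Icc (0 : ℝ) 1, P.arc e t ∈ closure (P.comp univ p) := by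
      intro t ht
      have h1 : t ∈ closure (Ioo (0 : ℝ) 1) := by rwa [closure_Ioo (by norm_num)]
      have h2 := ((P.arc_cont e) t ht).mono Ioo_subset_Icc_self
      refine closure_minimal ?_ isClosed_closure (h2.mem_closure_image h1)
      rintro _ ⟨s, hs, rfl⟩
      exact hint s hs
    rcases he with rfl | rfl
    · rw [← P.arc_zero]; exact hcl 0 (by simp)
    · rw [← P.arc_one]; exact hcl 1 (by simp)

theorem finite_face [Finite V] [Finite E] (hlr : P.SideFaces l r) [Nonempty E] : Finite P.Face := by
  obtain ⟨e⟩ := ‹Nonempty E›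
  have : (univ : Set P.Face) ⊆ range l ∪ range r := by
    intro f _
    exact (EdgeConn.mem_of_closed (P := fun f => f ∈ range l ∪ range r)
      (fun e _ => ⟨fun _ => Or.inr ⟨e, rfl⟩, fun _ => Or.inl ⟨e, rfl⟩⟩)
      (edgeConn_univ hlr (l e) f)).1 (Or.inl ⟨e, rfl⟩)
  exact finite_univ_iff.1 (((finite_range l).union (finite_range r)).subset this)

end PlaneGraph

end

section

open Set

namespace EdgeConn

variable {α E : Type*} {a b : E → α} {S T : Set E}

theorem insert_iff {e : E} {x y : α} : EdgeConn a b (insert e S) x y ↔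
    EdgeConn a b S x y ∨ (EdgeConn a b S x (a e) ∧ EdgeConn a b S y (b e)) ∨
      (EdgeConn a b S x (b e) ∧ EdgeConn a b S y (a e)) := by
  set r := EdgeConn a b S with hr
  have symm : ∀ {x y}, r x y → r y x := fun h => Setoid.symm' _ h
  have trans : ∀ {x y z}, r x y → r y z → r x z := fun h h' => Setoid.trans' _ h h'
  constructor
  · intro h
    have key := mem_of_edges (r := Setoid.ker fun z => {w | r z w ∨ (r z (a e) ∧ r w (b e)) ∨
      (r z (b e) ∧ r w (a e))}) ?_ h
    · have : y ∈ {w | r y w ∨ (r y (a e) ∧ r w (b e)) ∨ (r y (b e) ∧ r w (a e))} :=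
        Or.inl (Setoid.refl' _ _)
      rw [Setoid.ker_def] at key
      rwa [← key] at this
    · intro d hd
      rw [Setoid.ker_def]
      ext w
      simp only [mem_ofPred_eq]
      have ha : r (a e) (a e) := Setoid.refl' _ _
      have hb : r (b e) (b e) := Setoid.refl' _ _
      rcases hd with rfl | hd
      · constructor
        · rintro (h | ⟨h, h'⟩ | ⟨h, h'⟩)
          · exact Or.inr (Or.inr ⟨hb, symm h⟩)
          · exact Or.inl (symm h')
          · exact Or.inl (trans (symm h) (symm h'))
        · rintro (h | ⟨h, h'⟩ | ⟨h, h'⟩)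
          · exact Or.inr (Or.inl ⟨ha, symm h⟩)
          · exact Or.inl (trans (symm h) (symm h'))
          · exact Or.inl (symm h')
      · have hd' : r (a d) (b d) := edge hd
        have : ∀ z, r (a d) z ↔ r (b d) z := fun z => ⟨trans (symm hd'), trans hd'⟩
        rw [this, this, this]
  · have he : EdgeConn a b (insert e S) (a e) (b e) := edge (mem_insert _ _)
    rintro (h | ⟨h, h'⟩ | ⟨h, h'⟩)
    · exact mono (subset_insert _ _) h
    · exact Setoid.trans' _ (mono (subset_insert _ _) h)
        (Setoid.trans' _ he (Setoid.symm' _ (mono (subset_insert _ _) h')))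
    · exact Setoid.trans' _ (mono (subset_insert _ _) h)
        (Setoid.trans' _ (Setoid.symm' _ he) (Setoid.symm' _ (mono (subset_insert _ _) h')))

/-- The number of connected components. -/
noncomputable def count (a b : E → α) (S : Set E) : ℕ := Nat.card (Quotient (EdgeConn a b S))

theorem insert_eq_of_conn {e : E} (h : EdgeConn a b S (a e) (b e)) :
    EdgeConn a b (insert e S) = EdgeConn a b S := by
  ext x y
  rw [insert_iff]
  refine ⟨?_, Or.inl⟩
  rintro (h' | ⟨h1, h2⟩ | ⟨h1, h2⟩)
  · exact h'
  · exact Setoid.trans' _ h1 (Setoid.trans' _ h (Setoid.symm' _ h2))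
  · exact Setoid.trans' _ h1 (Setoid.trans' _ (Setoid.symm' _ h) (Setoid.symm' _ h2))

theorem count_mono [Finite α] (h : S ⊆ T) : count a b T ≤ count a b S :=
  Nat.card_le_card_of_surjective (Quotient.map id fun _ _ h' => mono h h')
    (by rintro ⟨x⟩; exact ⟨⟦x⟧, rfl⟩)

theorem count_insert_lt [Finite α] {e : E} (h : ¬ EdgeConn a b S (a e) (b e)) :
    count a b (insert e S) < count a b S := by
  refine lt_of_le_of_ne (count_mono (subset_insert _ _)) fun hc => h ?_
  let φ : Quotient (EdgeConn a b S) → Quotient (EdgeConn a b (insert e S)) :=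
    Quotient.map id fun _ _ h' => mono (subset_insert _ _) h'
  have hφ : Function.Surjective φ := by rintro ⟨x⟩; exact ⟨⟦x⟧, rfl⟩
  have hb := (Nat.bijective_iff_surjective_and_card φ).2 ⟨hφ, hc.symm⟩
  exact Quotient.exact (hb.1 (Quotient.sound (edge (mem_insert e S)) : φ ⟦a e⟧ = φ ⟦b e⟧))

theorem count_le_insert [Finite α] (e : E) : count a b S ≤ count a b (insert e S) + 1 := by
  classical
  let φ : Quotient (EdgeConn a b S) → Option (Quotient (EdgeConn a b (insert e S))) := fun x =>
    if x = ⟦b e⟧ then none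
    else some (Quotient.map id (fun _ _ h' => mono (subset_insert _ _) h') x)
  have hφ : Function.Injective φ := by
    rintro ⟨x⟩ ⟨y⟩ hxy
    change (⟦x⟧ : Quotient _) = ⟦y⟧
    have hx : φ ⟦x⟧ = φ ⟦y⟧ := hxy
    by_cases h1 : (⟦x⟧ : Quotient (EdgeConn a b S)) = ⟦b e⟧ <;>
    by_cases h2 : (⟦y⟧ : Quotient (EdgeConn a b S)) = ⟦b e⟧
    · rw [h1, h2]
    · simp [φ, h1, h2] at hx
    · simp [φ, h1, h2] at hx
    · simp only [φ, h1, h2, if_false] at hx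
      have h3 : EdgeConn a b (insert e S) x y := Quotient.exact (Option.some_injective _ hx)
      rcases insert_iff.1 h3 with h | ⟨h, h'⟩ | ⟨h, h'⟩
      · exact Quotient.sound h
      · exact absurd (Quotient.sound h') h2
      · exact absurd (Quotient.sound h) h1
  have := Nat.card_le_card_of_injective φ hφ
  rwa [Finite.card_option] at this

theorem eq_of_empty {x y : α} (h : EdgeConn a b ∅ x y) : x = y :=
  mem_of_edges (r := ⊥) (by simp) h

theorem count_empty : count a b ∅ = Nat.card α := by
  refine Nat.card_congr (Equiv.ofBijective (Quotient.mk _) ⟨fun x y h => ?_, ?_⟩).symm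
  · exact eq_of_empty (Quotient.exact h)
  · rintro ⟨x⟩; exact ⟨x, rfl⟩

theorem count_le_one (h : ∀ x y, EdgeConn a b S x y) : count a b S ≤ 1 := by
  have : Subsingleton (Quotient (EdgeConn a b S)) :=
    ⟨by rintro ⟨x⟩ ⟨y⟩; exact Quotient.sound (h x y)⟩
  exact Finite.card_le_one_iff_subsingleton.2 this

theorem card_le_count [Finite α] {β : Type*} (φ : α → β) (hφ : Function.Surjective φ)
    (h : ∀ e ∈ S, φ (a e) = φ (b e)) : Nat.card β ≤ count a b S := by
  refine Nat.card_le_card_of_surjective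
    (Quotient.lift φ fun x y hxy => mem_of_edges (r := Setoid.ker φ) h hxy) fun y => ?_
  obtain ⟨x, rfl⟩ := hφ y
  exact ⟨⟦x⟧, rfl⟩

variable {β : Type*} {l r : E → β}

/-- The inequality in Euler's formula coming from the hard direction of duality. -/
theorem euler_of_not_both [Finite α] [Finite β] [Finite E]
    (h : ∀ S e, e ∉ S → EdgeConn a b S (a e) (b e) → ¬ EdgeConn l r (insert e S)ᶜ (l e) (r e))
    (S : Set E) : count a b S + S.ncard + count l r univ ≤ Nat.card α + count l r Sᶜ := by
  induction S, S.toFinite using Set.Finite.induction_on with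
  | empty => simp [count_empty]
  | @insert e S he _ ih =>
    have hS : Sᶜ = insert e (insert e S)ᶜ := by
      ext x; by_cases hx : x = e <;> simp [hx, he]
    rw [ncard_insert_of_notMem he]
    by_cases hc : EdgeConn a b S (a e) (b e)
    · have h1 := count_insert_lt (h S e he hc)
      rw [← hS] at h1
      have h2 : count a b (insert e S) ≤ count a b S := count_mono (subset_insert _ _)
      omega
    · have h1 := count_insert_lt hc
      have h2 : count l r Sᶜ ≤ count l r (insert e S)ᶜ :=
        count_mono (compl_subset_compl.2 (subset_insert _ _))
      omega

/-- The inequality in Euler's formula coming from the easy direction of duality. -/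
theorem euler_of_either [Finite α] [Finite β] [Finite E]
    (h : ∀ S e, e ∉ S → EdgeConn a b S (a e) (b e) ∨ EdgeConn l r (insert e S)ᶜ (l e) (r e))
    (B : Set E) : ∀ T : Set E, Disjoint B T →
      count l r (B ∪ T)ᶜ + count a b B ≤ count l r Bᶜ + count a b (B ∪ T) + T.ncard := by
  intro T
  induction T, T.toFinite using Set.Finite.induction_on with
  | empty => simp
  | @insert e T he _ ih =>
    intro hd
    rw [disjoint_insert_right] at hd
    have ih := ih hd.2
    have heS : e ∉ B ∪ T := by simp [hd.1, he]
    rw [ncard_insert_of_notMem he, union_insert]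
    set S := B ∪ T
    have hS : Sᶜ = insert e (insert e S)ᶜ := by
      ext x; by_cases hx : x = e <;> simp [hx, heS]
    rcases h S e heS with hc | hc
    · have h1 : count a b (insert e S) = count a b S := by unfold count; rw [insert_eq_of_conn hc]
      have h2 : count l r (insert e S)ᶜ ≤ count l r (insert e (insert e S)ᶜ) + 1 := count_le_insert e
      rw [← hS] at h2
      omega
    · have h1 : count a b S ≤ count a b (insert e S) + 1 := count_le_insert e
      have h2 : count l r (insert e (insert e S)ᶜ) = count l r (insert e S)ᶜ := by
        unfold count; rw [insert_eq_of_conn hc]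
      rw [← hS] at h2
      omega

end EdgeConn

end

section

open Set

/-- A loopless 2-connected multigraph (ends `a`, `b`) of minimum degree at least three neighbours,
with a dual multigraph on the same edges (ends `l`, `r`). -/
structure DualPair (V F E : Type*) where
  a : E → V
  b : E → V
  l : E → F
  r : E → F
  a_ne_b : ∀ e, a e ≠ b e
  l_ne_r : ∀ e, l e ≠ r e
  duality : ∀ S e, e ∉ S →
    (EdgeConn a b S (a e) (b e) ↔ ¬ EdgeConn l r (insert e S)ᶜ (l e) (r e))
  conn_dual : ∀ f g, EdgeConn l r univ f g
  conn_avoid : ∀ x u v, u ≠ x → v ≠ x → EdgeConn a b {e | a e ≠ x ∧ b e ≠ x} u v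
  exists_nbr : ∀ v u w, ∃ e, (a e = v ∧ b e ≠ u ∧ b e ≠ w) ∨ (b e = v ∧ a e ≠ u ∧ a e ≠ w)

namespace DualPair

variable {V F E : Type*} (X : DualPair V F E)

/-- The edge `e` is incident with the vertex `v`. -/
def At (e : E) (v : V) : Prop := X.a e = v ∨ X.b e = v

/-- The edge `e` is incident with the face `f`. -/
def Side (e : E) (f : F) : Prop := X.l e = f ∨ X.r e = f

variable {X}

theorem at_a (e : E) : X.At e (X.a e) := Or.inl rfl
theorem at_b (e : E) : X.At e (X.b e) := Or.inr rfl
theorem side_l (e : E) : X.Side e (X.l e) := Or.inl rfl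
theorem side_r (e : E) : X.Side e (X.r e) := Or.inr rfl

theorem exists_at (v : V) : ∃ e, X.At e v := by
  obtain ⟨e, h | h⟩ := X.exists_nbr v v v
  · exact ⟨e, Or.inl h.1⟩
  · exact ⟨e, Or.inr h.1⟩

theorem conn_univ (u v : V) : EdgeConn X.a X.b univ u v := by
  obtain ⟨x, hu, hv⟩ : ∃ x, u ≠ x ∧ v ≠ x := by
    obtain ⟨e, h | h⟩ := X.exists_nbr u v v
    · exact ⟨X.b e, h.1 ▸ X.a_ne_b e, h.2.1.symm⟩
    · exact ⟨X.a e, h.1 ▸ (X.a_ne_b e).symm, h.2.1.symm⟩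
  exact EdgeConn.mono (subset_univ _) (X.conn_avoid x u v hu hv)

theorem exists_other {e : E} {v : V} (h : X.At e v) : ∃ x, x ≠ v ∧
    ((X.a e = v ∧ X.b e = x) ∨ (X.a e = x ∧ X.b e = v)) := by
  rcases h with rfl | rfl
  · exact ⟨X.b e, (X.a_ne_b e).symm, Or.inl ⟨rfl, rfl⟩⟩
  · exact ⟨X.a e, X.a_ne_b e, Or.inr ⟨rfl, rfl⟩⟩

theorem exists_other_side {e : E} {f : F} (h : X.Side e f) : ∃ g, g ≠ f ∧
    ((X.l e = f ∧ X.r e = g) ∨ (X.l e = g ∧ X.r e = f)) := by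
  rcases h with rfl | rfl
  · exact ⟨X.r e, (X.l_ne_r e).symm, Or.inl ⟨rfl, rfl⟩⟩
  · exact ⟨X.l e, X.l_ne_r e, Or.inr ⟨rfl, rfl⟩⟩

/-- The other edges at an end of `e` connect the two faces at `e`. -/
theorem conn_star_diff {e : E} {v : V} (he : X.At e v) :
    EdgeConn X.l X.r ({d | X.At d v} \ {e}) (X.l e) (X.r e) := by
  have hS : e ∉ {d | X.At d v}ᶜ := fun h => h he
  have h := X.duality _ e hS
  have hc : (insert e {d | X.At d v}ᶜ)ᶜ = {d | X.At d v} \ {e} := by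
    ext d; simp only [mem_compl_iff, mem_insert_iff, mem_sdiff, mem_singleton_iff, mem_ofPred_eq]; grind
  rw [hc] at h
  by_contra hcon
  have h1 := h.2 hcon
  have key : ∀ x y, EdgeConn X.a X.b {d | X.At d v}ᶜ x y → (x = v ↔ y = v) := fun x y =>
    EdgeConn.mem_of_closed (P := fun x => x = v) fun d hd =>
      ⟨fun h => absurd (Or.inl h) hd, fun h => absurd (Or.inr h) hd⟩
  have h2 := key _ _ h1
  have h3 := X.a_ne_b e
  rcases he with he | he
  · exact h3 (he.trans (h2.1 he).symm)
  · exact h3 ((h2.2 he).trans he.symm)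

/-- Omitting a further edge at `v` disconnects the two faces at `e`. -/
theorem not_conn_star_diff {e e' : E} {v : V} (he : X.At e v) (he' : X.At e' v) (hne : e ≠ e') :
    ¬ EdgeConn X.l X.r ({d | X.At d v} \ {e, e'}) (X.l e) (X.r e) := by
  have hS : e ∉ insert e' {d | X.At d v}ᶜ := by
    rintro (h | h)
    · exact hne h
    · exact h he
  have h := X.duality _ e hS
  have hc : (insert e (insert e' {d | X.At d v}ᶜ))ᶜ = {d | X.At d v} \ {e, e'} := by
    ext d; simp only [mem_compl_iff, mem_insert_iff, mem_sdiff, mem_singleton_iff, mem_ofPred_eq]; grind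
  rw [hc] at h
  refine h.1 ?_
  obtain ⟨x, hx, hex⟩ := exists_other he
  obtain ⟨y, hy, hey⟩ := exists_other he'
  have h1 : EdgeConn X.a X.b (insert e' {d | X.At d v}ᶜ) x y :=
    EdgeConn.mono (fun d hd => Or.inr fun h => h.elim hd.1 hd.2) (X.conn_avoid v x y hx hy)
  have h2 : EdgeConn X.a X.b (insert e' {d | X.At d v}ᶜ) (X.a e') (X.b e') :=
    EdgeConn.edge (mem_insert _ _)
  have h3 : EdgeConn X.a X.b (insert e' {d | X.At d v}ᶜ) x v := by
    refine Setoid.trans' _ h1 ?_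
    rcases hey with ⟨h3, h4⟩ | ⟨h3, h4⟩
    · rw [h3, h4] at h2; exact Setoid.symm' _ h2
    · rw [h3, h4] at h2; exact h2
  rcases hex with ⟨h4, h5⟩ | ⟨h4, h5⟩
  · rw [h4, h5]; exact Setoid.symm' _ h3
  · rw [h4, h5]; exact h3

theorem exists_second_edge {e : E} {v : V} {f : F} (he : X.At e v) (hf : X.Side e f) :
    ∃ d, d ≠ e ∧ X.At d v ∧ X.Side d f := by
  by_contra! hcon
  have h := conn_star_diff he
  have key := EdgeConn.mem_of_closed (P := fun x => x = f) (S := {d | X.At d v} \ {e})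
    (fun d hd => ⟨fun h => absurd (Or.inl h) (hcon d hd.2 hd.1),
      fun h => absurd (Or.inr h) (hcon d hd.2 hd.1)⟩) h
  have h3 := X.l_ne_r e
  rcases hf with hf | hf
  · exact h3 (hf.trans (key.1 hf).symm)
  · exact h3 ((key.2 hf).trans hf.symm)

theorem not_three_edges {e₁ e₂ e₃ : E} {v : V} {f : F} (h12 : e₁ ≠ e₂) (h13 : e₁ ≠ e₃)
    (h23 : e₂ ≠ e₃) (a₁ : X.At e₁ v) (a₂ : X.At e₂ v) (a₃ : X.At e₃ v) (s₁ : X.Side e₁ f)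
    (s₂ : X.Side e₂ f) (s₃ : X.Side e₃ f) : False := by
  set T := {d | X.At d v} \ {e₁, e₂, e₃} with hT
  have hi : ∀ (S : Set E) (e : E) (g x y), ((X.l e = f ∧ X.r e = g) ∨ (X.l e = g ∧ X.r e = f)) →
      (EdgeConn X.l X.r (insert e S) x y ↔ EdgeConn X.l X.r S x y ∨
        (EdgeConn X.l X.r S x f ∧ EdgeConn X.l X.r S y g) ∨
        (EdgeConn X.l X.r S x g ∧ EdgeConn X.l X.r S y f)) := by
    intro S e g x y h
    rw [EdgeConn.insert_iff]
    rcases h with ⟨h, h'⟩ | ⟨h, h'⟩ <;> rw [h, h'] <;> tauto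
  have hs : ∀ (S : Set E) (e : E) (g), ((X.l e = f ∧ X.r e = g) ∨ (X.l e = g ∧ X.r e = f)) →
      (EdgeConn X.l X.r S (X.l e) (X.r e) ↔ EdgeConn X.l X.r S g f) := by
    intro S e g h
    rcases h with ⟨h, h'⟩ | ⟨h, h'⟩ <;> rw [h, h']
    exact ⟨fun h => Setoid.symm' _ h, fun h => Setoid.symm' _ h⟩
  obtain ⟨g₁, -, o₁⟩ := exists_other_side s₁
  obtain ⟨g₂, -, o₂⟩ := exists_other_side s₂
  obtain ⟨g₃, -, o₃⟩ := exists_other_side s₃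
  have c1 := conn_star_diff a₁
  have n12 := not_conn_star_diff a₁ a₂ h12
  have n13 := not_conn_star_diff a₁ a₃ h13
  have n31 := not_conn_star_diff a₃ a₁ h13.symm
  have E1 : {d | X.At d v} \ {e₁} = insert e₃ (insert e₂ T) := by
    ext d; simp only [hT, mem_insert_iff, mem_sdiff, mem_singleton_iff, mem_ofPred_eq]
    by_cases d = e₂ <;> by_cases d = e₃ <;> simp_all [Ne.symm]
  have E12 : {d | X.At d v} \ {e₁, e₂} = insert e₃ T := by
    ext d; simp only [hT, mem_insert_iff, mem_sdiff, mem_singleton_iff, mem_ofPred_eq]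
    by_cases d = e₂ <;> by_cases d = e₃ <;> simp_all [Ne.symm]
  have E13 : {d | X.At d v} \ {e₁, e₃} = insert e₂ T := by
    ext d; simp only [hT, mem_insert_iff, mem_sdiff, mem_singleton_iff, mem_ofPred_eq]
    by_cases d = e₂ <;> by_cases d = e₃ <;> simp_all [Ne.symm]
  have E31 : {d | X.At d v} \ {e₃, e₁} = insert e₂ T := by rw [pair_comm, E13]
  rw [hs _ _ _ o₁] at c1 n12 n13
  rw [hs _ _ _ o₃] at n31
  rw [E1, hi _ _ _ _ _ o₃] at c1
  simp only [hi T e₂ g₂ _ _ o₂] at c1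
  rw [E12, hi _ _ _ _ _ o₃] at n12
  rw [E13, hi _ _ _ _ _ o₂] at n13
  rw [E31, hi _ _ _ _ _ o₂] at n31
  have rf : ∀ x, EdgeConn X.l X.r T x x := fun x => Setoid.refl' _ x
  have sy : ∀ {x y}, EdgeConn X.l X.r T x y → EdgeConn X.l X.r T y x := fun h => Setoid.symm' _ h
  have tr : ∀ {x y z}, EdgeConn X.l X.r T x y → EdgeConn X.l X.r T y z → EdgeConn X.l X.r T x z :=
    fun h h' => Setoid.trans' _ h h'
  push Not at n12 n13 n31
  grind

/-- The edges at a vertex are connected through the faces they share. -/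
theorem star_connected {v : V} {T : Set E}
    (hT : ∀ d e f, X.At d v → X.At e v → X.Side d f → X.Side e f → d ∈ T → e ∈ T)
    {e e' : E} (he : X.At e v) (he' : X.At e' v) (heT : e ∈ T) : e' ∈ T := by
  by_contra he'T
  have hne : e ≠ e' := by rintro rfl; exact he'T heT
  refine not_conn_star_diff he he' hne ?_
  set A := ({d | X.At d v} ∩ T) \ {e} with hA
  have key := EdgeConn.mem_of_closed (a := X.l) (b := X.r) (S := {d | X.At d v} \ {e})
    (P := fun z => (∃ d, X.At d v ∧ d ∈ T ∧ X.Side d z) ∧ EdgeConn X.l X.r A (X.l e) z)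
    (by
      rintro d ⟨hdv, hde⟩
      constructor
      · rintro ⟨⟨c, hc, hcT, hcs⟩, hcon⟩
        have hdT := hT c d _ hc hdv hcs (side_l d) hcT
        exact ⟨⟨d, hdv, hdT, side_r d⟩, Setoid.trans' _ hcon (EdgeConn.edge ⟨⟨hdv, hdT⟩, hde⟩)⟩
      · rintro ⟨⟨c, hc, hcT, hcs⟩, hcon⟩
        have hdT := hT c d _ hc hdv hcs (side_r d) hcT
        exact ⟨⟨d, hdv, hdT, side_l d⟩,
          Setoid.trans' _ hcon (Setoid.symm' _ (EdgeConn.edge ⟨⟨hdv, hdT⟩, hde⟩))⟩)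
    (conn_star_diff he)
  refine EdgeConn.mono ?_ (key.1 ⟨⟨e, he, heT, side_l e⟩, Setoid.refl' _ _⟩).2
  rintro d ⟨⟨hdv, hdT⟩, hde⟩
  refine ⟨hdv, ?_⟩
  rintro (h | h)
  · exact hde h
  · exact he'T (h ▸ hdT)

end DualPair

end

section

open Set

namespace DualPair

variable {V F E : Type*}

/-- The incident vertex-face pairs. -/
def Corner (X : DualPair V F E) : Type _ := {c : V × F // ∃ e, X.At e c.1 ∧ X.Side e c.2}

variable {X : DualPair V F E}

namespace Corner

theorem exists_pair (c : X.Corner) : ∃ p q : E, p ≠ q ∧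
    ∀ e, (X.At e c.1.1 ∧ X.Side e c.1.2) ↔ (e = p ∨ e = q) := by
  obtain ⟨⟨v, f⟩, p, hp, hp'⟩ := c
  obtain ⟨q, hqp, hq, hq'⟩ := exists_second_edge hp hp'
  refine ⟨p, q, hqp.symm, fun e => ⟨fun ⟨h, h'⟩ => ?_, ?_⟩⟩
  · by_contra! hcon
    exact not_three_edges hqp.symm hcon.1.symm hcon.2.symm hp hq h hp' hq' h'
  · rintro (rfl | rfl)
    · exact ⟨hp, hp'⟩
    · exact ⟨hq, hq'⟩

/-- One of the two edges at a corner. -/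
noncomputable def fst (c : X.Corner) : E := c.exists_pair.choose

/-- The other edge at a corner. -/
noncomputable def snd (c : X.Corner) : E := c.exists_pair.choose_spec.choose

/-- The vertex of a corner. -/
def vert (c : X.Corner) : V := c.1.1

/-- The face of a corner. -/
def face (c : X.Corner) : F := c.1.2

theorem fst_ne_snd (c : X.Corner) : c.fst ≠ c.snd := c.exists_pair.choose_spec.choose_spec.1

theorem iff_fst_or_snd (c : X.Corner) (e : E) :
    (X.At e c.vert ∧ X.Side e c.face) ↔ (e = c.fst ∨ e = c.snd) :=
  c.exists_pair.choose_spec.choose_spec.2 e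

theorem ext_vert_face {c d : X.Corner} (h : c.vert = d.vert) (h' : c.face = d.face) : c = d :=
  Subtype.ext (Prod.ext h h')

instance [Finite V] [Finite F] : Finite X.Corner := Subtype.finite

end Corner

theorem sum_corner {M : Type*} [AddCommMonoid M] [Fintype V] [Fintype F] [Fintype E]
    [Fintype X.Corner] (g : E → V → F → M) :
    ∑ c : X.Corner, (g c.fst c.vert c.face + g c.snd c.vert c.face) =
      ∑ e, ((g e (X.a e) (X.l e) + g e (X.a e) (X.r e)) +
        (g e (X.b e) (X.l e) + g e (X.b e) (X.r e))) := by
  classical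
  trans ∑ x : V × F, ∑ e, if X.At e x.1 ∧ X.Side e x.2 then g e x.1 x.2 else 0
  · rw [← Finset.sum_filter_of_ne (p := fun x : V × F => ∃ e, X.At e x.1 ∧ X.Side e x.2)]
    · rw [Finset.sum_subtype _ (p := fun x : V × F => ∃ e, X.At e x.1 ∧ X.Side e x.2) (by simp)]
      refine Fintype.sum_equiv (Equiv.refl _) _ _ fun c => ?_
      have : ∀ e, (X.At e c.1.1 ∧ X.Side e c.1.2) ↔ (e = c.fst ∨ e = c.snd) := c.iff_fst_or_snd
      change _ = ∑ e, if X.At e c.1.1 ∧ X.Side e c.1.2 then g e c.1.1 c.1.2 else 0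
      simp only [this]
      rw [← Finset.sum_filter, show Finset.univ.filter (fun e => e = c.fst ∨ e = c.snd) =
        {c.fst, c.snd} by ext; simp, Finset.sum_pair c.fst_ne_snd]
      rfl
    · intro x _ hx
      by_contra! hcon
      exact hx (Finset.sum_eq_zero fun e _ => if_neg fun h => hcon e h.1 h.2)
  · rw [Finset.sum_comm]
    refine Finset.sum_congr rfl fun e _ => ?_
    rw [Fintype.sum_prod_type]
    have h1 : ∀ (h : F → M), (∑ f, if X.Side e f then h f else 0) = h (X.l e) + h (X.r e) := by
      intro h
      rw [← Finset.sum_filter, show Finset.univ.filter (fun f => X.Side e f) =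
        {X.l e, X.r e} by ext; simp [Side, eq_comm], Finset.sum_pair (X.l_ne_r e)]
    have h2 : ∀ (h : V → M), (∑ f, if X.At e f then h f else 0) = h (X.a e) + h (X.b e) := by
      intro h
      rw [← Finset.sum_filter, show Finset.univ.filter (fun f => X.At e f) =
        {X.a e, X.b e} by ext; simp [At, eq_comm], Finset.sum_pair (X.a_ne_b e)]
    rw [← h1, ← h1, ← h2 (fun v => ∑ f, if X.Side e f then g e v f else 0)]
    refine Finset.sum_congr rfl fun v _ => ?_
    by_cases hv : X.At e v <;> simp [hv]

theorem card_corner [Finite V] [Finite F] [Finite E] :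
    Nat.card X.Corner = 2 * Nat.card E := by
  have := Fintype.ofFinite V
  have := Fintype.ofFinite F
  have := Fintype.ofFinite E
  have := Fintype.ofFinite X.Corner
  have h := sum_corner (X := X) (fun _ _ _ => (1 : ℕ))
  simp only [Finset.sum_const, Finset.card_univ, smul_eq_mul] at h
  rw [Nat.card_eq_fintype_card, Nat.card_eq_fintype_card]
  omega

theorem sum_corner_eq_zero [Fintype V] [Fintype F] [Fintype E]
    [Fintype X.Corner] (x : E → ZMod 2) (y : V → ZMod 2) (y' : F → ZMod 2) :
    ∑ c : X.Corner, (x c.fst + x c.snd) * (y c.vert + y' c.face) = 0 := by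
  have h := sum_corner (X := X) (fun e v f => x e * (y v + y' f))
  simp only [← add_mul] at h
  rw [h]
  refine Finset.sum_eq_zero fun e _ => ?_
  generalize x e = i
  generalize y (X.a e) = j
  generalize y (X.b e) = k
  generalize y' (X.l e) = m
  generalize y' (X.r e) = n
  revert i j k m n
  decide

/-- The graph whose edges join the vertex and the face of each corner, and the graph on the edges
which joins the two edges of each corner. -/
theorem conn_corner_or [Finite V] [Finite F] [Finite E] (S : Set X.Corner)
    (b : X.Corner) :
    EdgeConn (fun c : X.Corner => (Sum.inl c.vert : V ⊕ F)) (fun c => Sum.inr c.face) S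
      (Sum.inl b.vert) (Sum.inr b.face) ∨
    EdgeConn Corner.fst Corner.snd (insert b S)ᶜ b.fst b.snd := by
  classical
  have := Fintype.ofFinite V
  have := Fintype.ofFinite F
  have := Fintype.ofFinite E
  have := Fintype.ofFinite X.Corner
  by_contra! hcon
  obtain ⟨h1, h2⟩ := hcon
  set R := EdgeConn (fun c : X.Corner => (Sum.inl c.vert : V ⊕ F)) (fun c => Sum.inr c.face) S
  set R' := EdgeConn (Corner.fst (X := X)) Corner.snd (insert b S)ᶜ
  have h := sum_corner_eq_zero (X := X) (fun e => if R' b.fst e then 1 else 0)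
    (fun v => if R (Sum.inl b.vert) (Sum.inl v) then 1 else 0)
    (fun f => if R (Sum.inl b.vert) (Sum.inr f) then 1 else 0)
  rw [Finset.sum_eq_single b] at h
  · simp [h1, h2] at h
  · intro c _ hcb
    by_cases hc : c ∈ S
    · have e : R (Sum.inl c.vert) (Sum.inr c.face) := EdgeConn.edge hc
      have e' : R (Sum.inl b.vert) (Sum.inl c.vert) ↔ R (Sum.inl b.vert) (Sum.inr c.face) :=
        ⟨fun h => Setoid.trans' _ h e, fun h => Setoid.trans' _ h (Setoid.symm' _ e)⟩
      simp only [e', CharTwo.add_self_eq_zero, mul_zero]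
    · have e : R' c.fst c.snd := EdgeConn.edge fun h => h.elim hcb hc
      have e' : R' b.fst c.fst ↔ R' b.fst c.snd :=
        ⟨fun h => Setoid.trans' _ h e, fun h => Setoid.trans' _ h (Setoid.symm' _ e)⟩
      simp only [e', CharTwo.add_self_eq_zero, zero_mul]
  · simp

/-- The corners separating the edge set `T` from its complement. -/
def bd (X : DualPair V F E) (T : Set E) : Set X.Corner := {c | ¬ (c.fst ∈ T ↔ c.snd ∈ T)}

theorem bd_sum [Fintype V] [Fintype F] [Fintype E] [Fintype X.Corner] (T : Set E)
    (y : V → ZMod 2) (y' : F → ZMod 2) [DecidablePred (· ∈ X.bd T)] :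
    ∑ c : X.Corner, (if c ∈ X.bd T then (y c.vert + y' c.face) else 0) = 0 := by
  classical
  refine (Finset.sum_congr rfl fun c _ => ?_).trans
    (sum_corner_eq_zero (X := X) (fun e => if e ∈ T then 1 else 0) y y')
  by_cases h1 : c.fst ∈ T <;> by_cases h2 : c.snd ∈ T <;> simp [bd, h1, h2,
    CharTwo.add_self_eq_zero]

theorem even_bd [Finite V] [Finite F] [Finite E] (T : Set E) : Even (X.bd T).ncard := by
  classical
  have := Fintype.ofFinite V
  have := Fintype.ofFinite F
  have := Fintype.ofFinite E
  have := Fintype.ofFinite X.Corner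
  have h := bd_sum (X := X) T (fun _ => 1) (fun _ => 0)
  simp only [add_zero, Finset.sum_boole] at h
  rw [ZMod.natCast_eq_zero_iff_even] at h
  rwa [Set.ncard_eq_toFinset_card', show (X.bd T).toFinset = Finset.univ.filter (· ∈ X.bd T) by
    ext; simp]

theorem exists_bd_ne_of_vert [Finite V] [Finite F] [Finite E] {T : Set E} {c : X.Corner}
    (hc : c ∈ X.bd T) : ∃ d ∈ X.bd T, d.vert = c.vert ∧ d.face ≠ c.face := by
  classical
  have := Fintype.ofFinite V
  have := Fintype.ofFinite F
  have := Fintype.ofFinite E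
  have := Fintype.ofFinite X.Corner
  by_contra! hcon
  have h := bd_sum (X := X) T (fun v => if v = c.vert then 1 else 0) (fun _ => 0)
  rw [Finset.sum_eq_single c] at h
  · simp [hc] at h
  · intro d _ hd
    by_cases h1 : d ∈ X.bd T
    · by_cases h2 : d.vert = c.vert
      · exact absurd (Corner.ext_vert_face h2 (hcon d h1 h2)) hd
      · simp [h2]
    · simp [h1]
  · simp

theorem exists_bd_ne_of_face [Finite V] [Finite F] [Finite E] {T : Set E} {c : X.Corner}
    (hc : c ∈ X.bd T) : ∃ d ∈ X.bd T, d.face = c.face ∧ d.vert ≠ c.vert := by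
  classical
  have := Fintype.ofFinite V
  have := Fintype.ofFinite F
  have := Fintype.ofFinite E
  have := Fintype.ofFinite X.Corner
  by_contra! hcon
  have h := bd_sum (X := X) T (fun _ => 0) (fun f => if f = c.face then 1 else 0)
  rw [Finset.sum_eq_single c] at h
  · simp [hc] at h
  · intro d _ hd
    by_cases h1 : d ∈ X.bd T
    · by_cases h2 : d.face = c.face
      · exact absurd (Corner.ext_vert_face (hcon d h1 h2) h2) hd
      · simp [h2]
    · simp [h1]
  · simp

theorem mem_of_star {v : V} {T : Set E} (h : ∀ c ∈ X.bd T, c.vert ≠ v) {e e' : E}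
    (he : X.At e v) (he' : X.At e' v) (heT : e ∈ T) : e' ∈ T := by
  refine star_connected (X := X) (T := T) (v := v) ?_ he he' heT
  intro d d' f hd hd' sd sd' hdT
  let c : X.Corner := ⟨(v, f), d, hd, sd⟩
  have h1 : c.fst ∈ T ↔ c.snd ∈ T := not_not.1 fun h' => h c h' rfl
  have h2 := (c.iff_fst_or_snd d).1 ⟨hd, sd⟩
  have h3 := (c.iff_fst_or_snd d').1 ⟨hd', sd'⟩
  rcases h2 with h2 | h2 <;> rcases h3 with h3 | h3 <;> rw [h2] at hdT <;> rw [h3] <;> tauto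

theorem eq_univ_of_bd_eq_empty {T : Set E} (hT : T.Nonempty) (h : X.bd T = ∅) : T = univ := by
  obtain ⟨e, he⟩ := hT
  have key : ∀ v, ∀ d, X.At d v → d ∈ T := by
    intro v
    have := EdgeConn.mem_of_closed (a := X.a) (b := X.b) (S := univ)
      (P := fun v => ∀ d, X.At d v → d ∈ T) (fun d _ => ?_) (conn_univ (X.a e) v)
    · exact this.1 fun d hd => mem_of_star (by simp [h]) (at_a e) hd he
    · exact ⟨fun h' d' hd' => mem_of_star (by simp [h]) (at_b d) hd' (h' d (at_a d)),
        fun h' d' hd' => mem_of_star (by simp [h]) (at_a d) hd' (h' d (at_b d))⟩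
  exact eq_univ_of_forall fun d => key _ d (at_a d)

end DualPair

end

section

open Set

namespace DualPair

variable {V F E : Type*} {X : DualPair V F E}

/-- The vertex `v` is incident with the face `f`. -/
def Inc (X : DualPair V F E) (v : V) (f : F) : Prop := ∃ e, X.At e v ∧ X.Side e f

/-- The faces incident with exactly two vertices of `Y`. -/
def facesTwo (X : DualPair V F E) (Y : Set V) : Set F := {f | {y ∈ Y | X.Inc y f}.ncard = 2}

/-- The corners between `Y` and the faces incident with exactly two vertices of `Y`. -/
def cuts (X : DualPair V F E) (Y : Set V) : Set X.Corner :=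
  {c | c.vert ∈ Y ∧ c.face ∈ X.facesTwo Y}

theorem exists_side [Nonempty E] (f : F) : ∃ e, X.Side e f := by
  obtain ⟨e⟩ := ‹Nonempty E›
  refine (EdgeConn.mem_of_closed (P := fun z => ∃ e, X.Side e z) (fun d _ => ?_)
    (X.conn_dual (X.l e) f)).1 ⟨e, side_l e⟩
  exact ⟨fun _ => ⟨d, side_r d⟩, fun _ => ⟨d, side_l d⟩⟩

theorem conn_corner_univ [Nonempty E] (x y : V ⊕ F) :
    EdgeConn (fun c : X.Corner => (Sum.inl c.vert : V ⊕ F)) (fun c => Sum.inr c.face) univ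
      x y := by
  set R := EdgeConn (fun c : X.Corner => (Sum.inl c.vert : V ⊕ F)) (fun c => Sum.inr c.face) univ
    with hR
  have h0 : ∀ v f, X.Inc v f → R (Sum.inl v) (Sum.inr f) := fun v f h =>
    EdgeConn.edge (a := fun c : X.Corner => (Sum.inl c.vert : V ⊕ F)) (b := fun c => Sum.inr c.face)
      (e := (⟨(v, f), h⟩ : X.Corner)) (mem_univ _)
  have h1 : ∀ v w, R (Sum.inl v) (Sum.inl w) := fun v w =>
    EdgeConn.mem_of_edges (r := Setoid.comap Sum.inl R) (fun d _ =>
      R.trans' (h0 _ (X.l d) ⟨d, at_a d, side_l d⟩)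
        (R.symm' (h0 _ (X.l d) ⟨d, at_b d, side_l d⟩))) (conn_univ (X := X) v w)
  have h2 : ∀ x, ∃ v, R x (Sum.inl v) := by
    rintro (v | f)
    · exact ⟨v, Setoid.refl' _ _⟩
    · obtain ⟨e, he⟩ := exists_side (X := X) f
      exact ⟨X.a e, Setoid.symm' _ (h0 _ _ ⟨e, at_a e, he⟩)⟩
  obtain ⟨v, hv⟩ := h2 x
  obtain ⟨w, hw⟩ := h2 y
  exact Setoid.trans' _ (Setoid.trans' _ hv (h1 v w)) (Setoid.symm' _ hw)

theorem ncard_cuts [Finite V] [Finite F] (Y : Set V) :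
    (X.cuts Y).ncard = 2 * (X.facesTwo Y).ncard := by
  have := Fintype.ofFinite (X.facesTwo Y)
  let φ : X.cuts Y ≃ Σ f : X.facesTwo Y, {y | y ∈ Y ∧ X.Inc y f.1} :=
    { toFun := fun c => ⟨⟨c.1.face, c.2.2⟩, c.1.vert, c.2.1, c.1.2⟩
      invFun := fun x => ⟨⟨(x.2.1, x.1.1), x.2.2.2⟩, x.2.2.1, x.1.2⟩
      left_inv := fun _ => rfl
      right_inv := fun _ => rfl }
  have h : ∀ f : X.facesTwo Y, Nat.card {y | y ∈ Y ∧ X.Inc y f.1} = 2 := fun f => f.2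
  rw [← Nat.card_coe_set_eq, Nat.card_congr φ, Nat.card_sigma, Finset.sum_congr rfl fun f _ => h f,
    Finset.sum_const, Finset.card_univ, ← Nat.card_eq_fintype_card, Nat.card_coe_set_eq,
    smul_eq_mul, mul_comm]

theorem euler_le (X : DualPair V F E) [Finite V] [Finite F] [Finite E] [Nonempty E] :
    Nat.card E + 2 ≤ Nat.card V + Nat.card F := by
  have h := EdgeConn.euler_of_not_both (fun S e he => (X.duality S e he).1) univ
  obtain ⟨e⟩ := ‹Nonempty E›
  have h1 : 1 ≤ EdgeConn.count X.a X.b univ :=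
    Nat.one_le_iff_ne_zero.2 (Nat.card_ne_zero.2 ⟨⟨⟦X.a e⟧⟩, inferInstance⟩)
  have h2 : 1 ≤ EdgeConn.count X.l X.r univ :=
    Nat.one_le_iff_ne_zero.2 (Nat.card_ne_zero.2 ⟨⟨⟦X.l e⟧⟩, inferInstance⟩)
  rw [compl_univ, EdgeConn.count_empty, ncard_univ] at h
  omega

theorem facesTwo_le_count [Finite V] [Finite F] [Finite E] {Y : Set V} (hY : Y.Nonempty) :
    (X.facesTwo Y).ncard + 2 ≤
      EdgeConn.count Corner.fst Corner.snd (X.cuts Y)ᶜ + Y.ncard := by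
  classical
  obtain ⟨y, hy⟩ := hY
  have : Nonempty E := ⟨(exists_at (X := X) y).choose⟩
  have h1 := EdgeConn.euler_of_either (fun S e _ => conn_corner_or (X := X) S e) (X.cuts Y)
    (X.cuts Y)ᶜ disjoint_compl_right
  rw [union_compl_self, compl_univ, EdgeConn.count_empty] at h1
  have h2 := EdgeConn.count_le_one (conn_corner_univ (X := X))
  have h3 := ncard_add_ncard_compl (X.cuts Y)
  rw [card_corner, ncard_cuts] at h3
  have h4 := X.euler_le
  let φ : V ⊕ F → Option ((Yᶜ : Set V) ⊕ ((X.facesTwo Y)ᶜ : Set F)) := Sum.elim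
    (fun v => if h : v ∈ Y then none else some (Sum.inl ⟨v, h⟩))
    (fun f => if h : f ∈ X.facesTwo Y then none else some (Sum.inr ⟨f, h⟩))
  have h5 := EdgeConn.card_le_count (a := fun c : X.Corner => (Sum.inl c.vert : V ⊕ F))
    (b := fun c => Sum.inr c.face) (S := X.cuts Y) φ (by
      rintro (_ | ⟨v, hv⟩ | ⟨f, hf⟩)
      · exact ⟨Sum.inl y, dif_pos hy⟩
      · exact ⟨Sum.inl v, dif_neg hv⟩
      · exact ⟨Sum.inr f, dif_neg hf⟩) (fun c hc => by
      change dite _ _ _ = dite _ _ _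
      rw [dif_pos hc.1, dif_pos hc.2])
  rw [Finite.card_option, Nat.card_sum, Nat.card_coe_set_eq, Nat.card_coe_set_eq] at h5
  have h6 := ncard_add_ncard_compl Y
  have h7 := ncard_add_ncard_compl (X.facesTwo Y)
  omega

theorem four_le_bd [Finite V] [Finite F] [Finite E] {T : Set E} (hT : (X.bd T).Nonempty) :
    4 ≤ (X.bd T).ncard ∧ ((X.bd T).ncard = 4 → ∃ c ∈ X.bd T, ∃ d ∈ X.bd T, c.vert ≠ d.vert ∧
      ∀ x ∈ X.bd T, x.vert = c.vert ∨ x.vert = d.vert) := by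
  obtain ⟨c₁, h₁⟩ := hT
  obtain ⟨c₂, h₂, f₂, v₂⟩ := exists_bd_ne_of_face h₁
  obtain ⟨c₃, h₃, v₃, f₃⟩ := exists_bd_ne_of_vert h₁
  obtain ⟨c₄, h₄, f₄, v₄⟩ := exists_bd_ne_of_face h₃
  have hsub : {c₁, c₂, c₃, c₄} ⊆ X.bd T := by
    rintro x (rfl | rfl | rfl | rfl) <;> assumption
  have n12 : c₁ ≠ c₂ := by rintro rfl; exact v₂ rfl
  have n13 : c₁ ≠ c₃ := by rintro rfl; exact f₃ rfl
  have n14 : c₁ ≠ c₄ := by rintro rfl; exact f₃ f₄.symm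
  have n23 : c₂ ≠ c₃ := by rintro rfl; exact v₂ v₃
  have n24 : c₂ ≠ c₄ := by rintro rfl; exact f₃ (f₄.symm.trans f₂)
  have n34 : c₃ ≠ c₄ := by rintro rfl; exact v₄ rfl
  have hc : ({c₁, c₂, c₃, c₄} : Set X.Corner).ncard = 4 := by
    rw [ncard_insert_of_notMem (by simp [*]), ncard_insert_of_notMem (by simp [*]), ncard_pair n34]
  refine ⟨hc ▸ ncard_le_ncard hsub, fun h4 => ⟨c₁, h₁, c₂, h₂, v₂.symm, ?_⟩⟩
  have heq := eq_of_subset_of_ncard_le hsub (by rw [h4, hc])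
  have hv : c₄.vert = c₂.vert := by
    obtain ⟨d, hd, hdv, hdf⟩ := exists_bd_ne_of_vert h₂
    rw [← heq] at hd
    rcases hd with rfl | rfl | rfl | rfl
    · exact absurd hdv.symm v₂
    · exact absurd rfl hdf
    · exact absurd (hdv.symm.trans v₃) v₂
    · exact hdv
  rw [← heq]
  rintro x (rfl | rfl | rfl | rfl)
  · exact Or.inl rfl
  · exact Or.inr rfl
  · exact Or.inl v₃
  · exact Or.inr hv

/-- Disjoint nonempty edge sets attached at two vertices of `Y` only can be charged to `Z` and to
the edges inside `Y`. -/
theorem card_digons_le [Finite V] [Finite E] {Y Z : Set V}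
    (hcut : ∀ u v x, u ≠ v → x ≠ u → x ≠ v → ∀ Q : V → Prop, Q x →
      (∀ e, X.a e ≠ u → X.a e ≠ v → X.b e ≠ u → X.b e ≠ v → (Q (X.a e) ↔ Q (X.b e))) →
      (∃ z ∈ Z, Q z) ∨ ∀ w, w ≠ u → w ≠ v → Q w)
    {ι : Type*} (T : ι → Set E) (hdisj : ∀ i j e, e ∈ T i → e ∈ T j → i = j)
    (hne : ∀ i, (T i).Nonempty) (hT : ∀ i, ∃ u ∈ Y, ∃ v ∈ Y, u ≠ v ∧
      ∀ c ∈ X.bd (T i), c.vert = u ∨ c.vert = v) :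
    Nat.card ι ≤ Z.ncard + {e | X.a e ∈ Y ∧ X.b e ∈ Y}.ncard + 1 := by
  have key : ∀ i, ∃ o : Option (Z ⊕ {e | X.a e ∈ Y ∧ X.b e ∈ Y}),
      (∀ z, o = some (Sum.inl z) → ∀ e, X.At e z → e ∈ T i) ∧
      (∀ e, o = some (Sum.inr e) → e.1 ∈ T i) ∧
      (o = none → ∃ u v, ∀ w, w ≠ u → w ≠ v → ∀ e, X.At e w → e ∈ T i) := by
    intro i
    obtain ⟨u, hu, v, hv, huv, hbd⟩ := hT i
    by_cases hE : ∃ e ∈ T i, X.a e ∈ Y ∧ X.b e ∈ Y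
    · obtain ⟨e, he, heY⟩ := hE
      refine ⟨some (Sum.inr ⟨e, heY⟩), by simp, ?_, by simp⟩
      simp only [Option.some.injEq, Sum.inr.injEq, forall_eq']
      exact he
    · have hstar : ∀ w, w ≠ u → w ≠ v → ∀ e, X.At e w → e ∈ T i → ∀ e', X.At e' w → e' ∈ T i :=
        fun w hwu hwv e he heT e' he' => mem_of_star (fun c hc hcw =>
          (hbd c hc).elim (fun h => hwu (hcw.symm.trans h)) (fun h => hwv (hcw.symm.trans h)))
          he he' heT
      obtain ⟨e, he⟩ := hne i
      obtain ⟨x, hxe, hxY⟩ : ∃ x, X.At e x ∧ x ∉ Y := by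
        by_contra! hcon
        exact hE ⟨e, he, hcon _ (at_a e), hcon _ (at_b e)⟩
      have hxu : x ≠ u := fun h => hxY (h ▸ hu)
      have hxv : x ≠ v := fun h => hxY (h ▸ hv)
      rcases hcut u v x huv hxu hxv (fun w => ∀ e, X.At e w → e ∈ T i)
        (hstar x hxu hxv e hxe he) (fun d h1 h2 h3 h4 =>
          ⟨fun h => hstar _ h3 h4 d (at_b d) (h d (at_a d)),
            fun h => hstar _ h1 h2 d (at_a d) (h d (at_b d))⟩) with ⟨z, hz, hQ⟩ | hQ
      · refine ⟨some (Sum.inl ⟨z, hz⟩), ?_, by simp, by simp⟩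
        simp only [Option.some.injEq, Sum.inl.injEq, forall_eq']
        exact hQ
      · exact ⟨none, by simp, by simp, fun _ => ⟨u, v, hQ⟩⟩
  choose g hg1 hg2 hg3 using key
  have hg : Function.Injective g := by
    intro i j hij
    rcases ho : g j with _ | z | e
    · obtain ⟨u, v, h⟩ := hg3 i (hij.trans ho)
      obtain ⟨u', v', h'⟩ := hg3 j ho
      obtain ⟨x, hxu, hxv⟩ : ∃ x, x ≠ u ∧ x ≠ v := by
        obtain ⟨e, ⟨-, h⟩ | ⟨-, h⟩⟩ := X.exists_nbr u u v
        exacts [⟨_, h⟩, ⟨_, h⟩]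
      obtain ⟨e, ⟨he, h1, h2⟩ | ⟨he, h1, h2⟩⟩ := X.exists_nbr x u' v'
      · exact hdisj i j e (h x hxu hxv e (Or.inl he)) (h' _ h1 h2 e (at_b e))
      · exact hdisj i j e (h x hxu hxv e (Or.inr he)) (h' _ h1 h2 e (at_a e))
    · obtain ⟨e, he⟩ := exists_at (X := X) z.1
      exact hdisj i j e (hg1 i z (hij.trans ho) e he) (hg1 j z ho e he)
    · exact hdisj i j e.1 (hg2 i e (hij.trans ho)) (hg2 j e ho)
  have h := Nat.card_le_card_of_injective g hg
  rwa [Finite.card_option, Nat.card_sum, Nat.card_coe_set_eq, Nat.card_coe_set_eq] at h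

theorem ncard_facesTwo_le [Finite V] [Finite F] [Finite E] {Y Z : Set V}
    (hcut : ∀ u v x, u ≠ v → x ≠ u → x ≠ v → ∀ Q : V → Prop, Q x →
      (∀ e, X.a e ≠ u → X.a e ≠ v → X.b e ≠ u → X.b e ≠ v → (Q (X.a e) ↔ Q (X.b e))) →
      (∃ z ∈ Z, Q z) ∨ ∀ w, w ≠ u → w ≠ v → Q w) :
    (X.facesTwo Y).ncard ≤ 3 * Y.ncard + Z.ncard + {e | X.a e ∈ Y ∧ X.b e ∈ Y}.ncard := by
  classical
  rcases Y.eq_empty_or_nonempty with rfl | hY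
  · simp [facesTwo]
  have h1 := facesTwo_le_count (X := X) hY
  set R := EdgeConn Corner.fst Corner.snd (X.cuts Y)ᶜ with hR
  rw [EdgeConn.count] at h1
  set K := Quotient R with hK
  by_cases hN : Nat.card K ≤ 1
  · have : Y.ncard ≤ 3 * Y.ncard := by omega
    omega
  let T : K → Set E := fun κ => {e | (⟦e⟧ : K) = κ}
  have hsub : ∀ κ, X.bd (T κ) ⊆ X.cuts Y := by
    intro κ c hc
    by_contra hcon
    have : (⟦c.fst⟧ : K) = ⟦c.snd⟧ := Quotient.sound (EdgeConn.edge hcon)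
    exact hc (by change _ = _ ↔ _ = _; rw [this])
  have hTne : ∀ κ, (T κ).Nonempty := by rintro ⟨e⟩; exact ⟨e, rfl⟩
  have hbd : ∀ κ, (X.bd (T κ)).Nonempty := by
    intro κ
    by_contra hcon
    have h := eq_univ_of_bd_eq_empty (hTne κ) (not_nonempty_iff_eq_empty.1 hcon)
    refine hN (Finite.card_le_one_iff_subsingleton.2 ⟨?_⟩)
    have : ∀ κ', κ' = κ := by
      rintro ⟨e⟩
      exact (h ▸ mem_univ e : e ∈ T κ)
    intro x y
    rw [this x, this y]
  have := Fintype.ofFinite K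
  have := Fintype.ofFinite E
  have := Fintype.ofFinite X.Corner
  have hsum : ∑ κ, (X.bd (T κ)).ncard ≤ 2 * (X.cuts Y).ncard := by
    have e1 : ∀ κ, (X.bd (T κ)).ncard =
        ∑ c ∈ (X.cuts Y).toFinset, if c ∈ X.bd (T κ) then 1 else 0 := by
      intro κ
      rw [← Finset.sum_filter, Finset.sum_const, smul_eq_mul, mul_one, ← ncard_coe_finset]
      congr 1
      ext c
      simpa using fun h => hsub κ h
    rw [Finset.sum_congr rfl fun κ _ => e1 κ, Finset.sum_comm, ncard_eq_toFinset_card', mul_comm,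
      ← smul_eq_mul, ← Finset.sum_const]
    refine Finset.sum_le_sum fun c _ => ?_
    rw [← Finset.sum_filter, Finset.sum_const, smul_eq_mul, mul_one]
    refine (Finset.card_le_card (t := {⟦c.fst⟧, ⟦c.snd⟧}) fun κ hκ => ?_).trans Finset.card_le_two
    have h : c ∈ X.bd (T κ) := (Finset.mem_filter.1 hκ).2
    rw [Finset.mem_insert, Finset.mem_singleton]
    by_contra! hcon
    exact h (iff_of_false (fun h => hcon.1 h.symm) (fun h => hcon.2 h.symm))
  have hdig := card_digons_le (X := X) hcut
    (fun κ : {κ // (X.bd (T κ)).ncard = 4} => T κ.1)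
    (fun i j e hi hj => Subtype.ext ((show (⟦e⟧ : K) = i.1 from hi).symm.trans hj))
    (fun κ => hTne κ.1) (fun κ => by
      obtain ⟨c, hc, d, hd, hne, h⟩ := (four_le_bd (hbd κ.1)).2 κ.2
      exact ⟨_, (hsub _ hc).1, _, (hsub _ hd).1, hne, h⟩)
  have hlow : 6 * Nat.card K ≤
      ∑ κ, (X.bd (T κ)).ncard + 2 * Nat.card {κ // (X.bd (T κ)).ncard = 4} := by
    have e1 : Nat.card {κ // (X.bd (T κ)).ncard = 4} =
        ∑ κ, if (X.bd (T κ)).ncard = 4 then 1 else 0 := by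
      rw [Nat.card_eq_fintype_card, Fintype.card_subtype, Finset.card_filter]
    rw [e1, Finset.mul_sum, ← Finset.sum_add_distrib, Nat.card_eq_fintype_card, mul_comm,
      ← smul_eq_mul, ← Finset.card_univ, ← Finset.sum_const]
    refine Finset.sum_le_sum fun κ _ => ?_
    have h4 := (four_le_bd (hbd κ)).1
    obtain ⟨k, hk⟩ := even_bd (X := X) (T κ)
    split_ifs <;> omega
  rw [ncard_cuts] at hsum
  omega

end DualPair

end

section

open Set

namespace Multigraph

variable {V E : Type} {G : Multigraph V E} {a b : E → V}

theorem edgeConn_of_reach (hab : ∀ e, G.ends e = s(a e, b e)) {A : Set V} {u v : V}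
    (h : G.Reach A ∅ u v) : EdgeConn a b {e | a e ∉ A ∧ b e ∉ A} u v := by
  induction h with
  | refl => exact Setoid.refl' _ _
  | @tail x y _ hxy ih =>
    obtain ⟨hx, hy, e, -, he⟩ := hxy
    refine Setoid.trans' _ ih ?_
    rw [hab, Sym2.eq_iff] at he
    rcases he with ⟨rfl, rfl⟩ | ⟨rfl, rfl⟩
    · exact EdgeConn.edge ⟨hx, hy⟩
    · exact Setoid.symm' _ (EdgeConn.edge ⟨hy, hx⟩)

theorem exists_edge_to [Finite V] (hab : ∀ e, G.ends e = s(a e, b e))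
    (hadj : ∀ v : V, 3 ≤ Set.ncard {u | G.Adj v u}) (v u w : V) :
    ∃ e, (a e = v ∧ b e ≠ u ∧ b e ≠ w) ∨ (b e = v ∧ a e ≠ u ∧ a e ≠ w) := by
  have h : ({u, w} : Set V).ncard < {x | G.Adj v x}.ncard :=
    ((ncard_insert_le u {w}).trans (by rw [ncard_singleton])).trans_lt (hadj v)
  obtain ⟨x, ⟨-, e, he⟩, hx⟩ := exists_mem_notMem_of_ncard_lt_ncard h
  rw [mem_insert_iff, mem_singleton_iff, not_or] at hx
  rw [hab, Sym2.eq_iff] at he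
  rcases he with ⟨h1, rfl⟩ | ⟨rfl, h1⟩
  · exact ⟨e, Or.inl ⟨h1, hx⟩⟩
  · exact ⟨e, Or.inr ⟨h1, hx⟩⟩

theorem IsAnchor.exists_mem_or (hab : ∀ e, G.ends e = s(a e, b e)) {Z : Set V}
    (hZ : G.IsAnchor Z) {u v x : V} (huv : u ≠ v) (hxu : x ≠ u) (hxv : x ≠ v) {Q : V → Prop}
    (hQx : Q x) (hQ : ∀ e, a e ≠ u → a e ≠ v → b e ≠ u → b e ≠ v → (Q (a e) ↔ Q (b e))) :
    (∃ z ∈ Z, Q z) ∨ ∀ w, w ≠ u → w ≠ v → Q w := by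
  have hx : x ∉ ({u, v} : Set V) := by simp [hxu, hxv]
  have key : ∀ y, G.Reach {u, v} ∅ x y → Q y := fun y h =>
    (EdgeConn.mem_of_closed (fun e he => by
      simp only [mem_insert_iff, mem_singleton_iff, not_or, mem_ofPred_eq] at he
      exact hQ e he.1.1 he.1.2 he.2.1 he.2.2) (edgeConn_of_reach hab h)).1 hQx
  by_cases hc : G.IsVertexCut2 u v
  · obtain ⟨z, hz, hzK⟩ := hZ.2 u v hc _ ⟨x, hx, rfl⟩
    exact Or.inl ⟨z, hz, key z hzK.2⟩
  · refine Or.inr fun w hwu hwv => key w ?_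
    by_contra hcon
    exact hc ⟨huv, x, w, hx, by simp [hwu, hwv], hcon⟩

end Multigraph

/-- The plane as the complex numbers. -/
noncomputable def planeHomeo : ℝ × ℝ ≃ₜ ℂ := Complex.equivRealProdCLM.symm.toHomeomorph

namespace Multigraph.Drawing

variable {V E : Type} {G : Multigraph V E} (D : G.Drawing)

/-- The source of an edge in the direction of its arc. -/
noncomputable def src (e : E) : V := (D.arc_ends e).choose

/-- The target of an edge in the direction of its arc. -/
noncomputable def tgt (e : E) : V := (D.arc_ends e).choose_spec.choose

theorem ends_eq (e : E) : G.ends e = s(D.src e, D.tgt e) :=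
  (D.arc_ends e).choose_spec.choose_spec.1

/-- A crossing-free drawing as a plane graph in the complex plane. -/
noncomputable def toPlaneGraph (hD : D.CrossSet = ∅) : PlaneGraph V E where
  pos v := planeHomeo (D.vpos v)
  arc e t := planeHomeo (D.arc e t)
  src := D.src
  tgt := D.tgt
  pos_inj := planeHomeo.injective.comp D.vpos_inj
  arc_cont e := planeHomeo.continuous.comp_continuousOn (D.arc_cont e)
  arc_inj e := planeHomeo.injective.comp_injOn (D.arc_inj e)
  arc_zero e := congrArg planeHomeo (D.arc_ends e).choose_spec.choose_spec.2.1
  arc_one e := congrArg planeHomeo (D.arc_ends e).choose_spec.choose_spec.2.2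
  arc_avoid e t ht x h := D.arc_avoid e t ht x (planeHomeo.injective h)
  arc_disj e e' hne s hs t ht h := by
    have : ((e, e'), s, t) ∈ D.CrossSet := ⟨hne, hs, ht, planeHomeo.injective h⟩
    rw [hD] at this
    exact this

variable {D}

theorem img_toPlaneGraph (hD : D.CrossSet = ∅) :
    (D.toPlaneGraph hD).img univ = planeHomeo '' D.image := by
  simp only [PlaneGraph.img, PlaneGraph.edgeSet, image, image_union, image_iUnion, mem_univ,
    iUnion_true, ← range_comp, ← image_comp]
  rfl

theorem image_mem_faces (hD : D.CrossSet = ∅) {C : Set (ℝ × ℝ)} (hC : C ∈ D.Faces) :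
    ∃ p ∉ (D.toPlaneGraph hD).img univ, planeHomeo '' C = (D.toPlaneGraph hD).comp univ p := by
  obtain ⟨p, hp, rfl⟩ := hC
  refine ⟨planeHomeo p, ?_, ?_⟩
  · rw [img_toPlaneGraph, planeHomeo.injective.mem_set_image]
    exact hp
  · rw [PlaneGraph.comp, img_toPlaneGraph, ← planeHomeo.image_compl,
      planeHomeo.image_connectedComponentIn hp]

/-- At most `3 |Y| + |Z| + |E_Y|` faces are incident with exactly two vertices of `Y`. -/
theorem ncard_faces_le [Finite V] [Finite E] (hloop : G.Loopless) (h2c : G.TwoConnected)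
    (hadj : ∀ v : V, 3 ≤ Set.ncard {u | G.Adj v u}) (hD : D.CrossSet = ∅)
    {Z : Set V} (hZ : G.IsAnchor Z) (Y : Set V) :
    Set.ncard {C ∈ D.Faces | Set.ncard {y ∈ Y | D.FaceIncident y C} = 2} ≤
      3 * Y.ncard + Z.ncard + Set.ncard {e : E | ∀ x ∈ G.ends e, x ∈ Y} := by
  set P := D.toPlaneGraph hD
  have hab : ∀ e, G.ends e = s(P.src e, P.tgt e) := D.ends_eq
  have hne : ∀ e, P.src e ≠ P.tgt e := fun e h => hloop e (by rw [hab e, h]; exact rfl)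
  have hnbr := Multigraph.exists_edge_to hab hadj
  have hconn : ∀ x u v, u ≠ x → v ≠ x →
      EdgeConn P.src P.tgt {e | P.src e ≠ x ∧ P.tgt e ≠ x} u v := fun x u v hu hv =>
    Multigraph.edgeConn_of_reach hab (h2c.2 x u v hu hv)
  have hB : ∀ e, EdgeConn P.src P.tgt {e}ᶜ (P.src e) (P.tgt e) := by
    intro e
    have h1 : ∀ w, w ≠ P.src e → EdgeConn P.src P.tgt {e}ᶜ w (P.tgt e) := fun w hw =>
      EdgeConn.mono (fun d hd hde => hd.1 (by rw [mem_singleton_iff.1 hde]))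
        (hconn (P.src e) w (P.tgt e) hw (hne e).symm)
    obtain ⟨d, ⟨h, h', -⟩ | ⟨h, h', -⟩⟩ := hnbr (P.src e) (P.tgt e) (P.tgt e)
    · have hd : d ∈ ({e}ᶜ : Set E) := by rintro rfl; exact h' rfl
      have h2 := h1 (P.tgt d) (h ▸ (hne d).symm)
      exact Setoid.trans' _ (h ▸ EdgeConn.edge hd) h2
    · have hd : d ∈ ({e}ᶜ : Set E) := by rintro rfl; exact hne d h.symm
      have h2 := h1 (P.src d) (h ▸ hne d)
      exact Setoid.trans' _ (Setoid.symm' _ (h ▸ EdgeConn.edge hd)) h2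
  obtain ⟨l, r, hlr⟩ := P.exists_sideFaces hB
  have hat : ∀ v, ∃ e, P.src e = v ∨ P.tgt e = v := fun v =>
    (hnbr v v v).imp fun e h => h.imp And.left And.left
  have : Nonempty V := (Nat.card_pos_iff.1 (by have := h2c.1; omega)).1
  have : Nonempty E := ⟨(hat (Classical.arbitrary V)).choose⟩
  have := PlaneGraph.finite_face hlr
  let X : DualPair V P.Face E :=
    { a := P.src
      b := P.tgt
      l := l
      r := r
      a_ne_b := hne
      l_ne_r := fun e => (hlr e).1
      duality := fun S e he => PlaneGraph.duality hlr he
      conn_dual := PlaneGraph.edgeConn_univ hlr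
      conn_avoid := hconn
      exists_nbr := hnbr }
  have key := X.ncard_facesTwo_le (Y := Y) (Z := Z)
    (fun u v x huv hxu hxv Q hQx hQ => hZ.exists_mem_or hab huv hxu hxv hQx hQ)
  have hE : {e : E | ∀ x ∈ G.ends e, x ∈ Y} = {e | X.a e ∈ Y ∧ X.b e ∈ Y} := by
    ext e
    simp [hab, X]
  rw [hE]
  refine le_trans ?_ key
  rw [← ncard_image_of_injective (X.facesTwo Y) Subtype.val_injective]
  refine ncard_le_ncard_of_injOn (fun C => planeHomeo '' C) ?_
    planeHomeo.injective.image_injective.injOn ((toFinite _).image _)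
  rintro C ⟨hC, hCY⟩
  refine ⟨⟨_, D.image_mem_faces hD hC⟩, ?_, rfl⟩
  change Set.ncard _ = 2
  rw [← hCY]
  congr 1
  ext y
  refine and_congr_right fun _ => ?_
  refine (PlaneGraph.mem_closure_face_iff hlr hat y _).symm.trans ?_
  change planeHomeo (D.vpos y) ∈ closure (planeHomeo '' C) ↔ _
  rw [← planeHomeo.image_closure, planeHomeo.injective.mem_set_image]
  rfl

end Multigraph.Drawing

end

/-- Let `G` be a 2-connected plane graph in which every vertex is
adjacent to at least 3 distinct vertices, `Z` an anchor, `Y ⊆ V \ Z`, and `E_Y` the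
edges with both endpoints in `Y`. Then at most `3|Y| + |Z| + |E_Y|` faces are
incident with exactly 2 vertices of `Y`. -/
theorem statement17 {V E : Type} [Fintype V] [Fintype E] (G : Multigraph V E)
    (hloop : G.Loopless) (h2c : G.TwoConnected)
    (hadj : ∀ v : V, 3 ≤ Set.ncard {u | G.Adj v u})
    (D : G.Drawing) (hD : D.CrossSet = ∅)
    (Z : Set V) (hZ : G.IsAnchor Z)
    (Y : Set V) (hYZ : Y ∩ Z = ∅) :
    Set.ncard {C ∈ D.Faces | Set.ncard {y ∈ Y | D.FaceIncident y C} = 2} ≤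
      3 * Y.ncard + Z.ncard + Set.ncard {e : E | ∀ x ∈ G.ends e, x ∈ Y} :=
  D.ncard_faces_le hloop h2c hadj hD hZ Y
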